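/- arXiv:1105.4533 — 2 statements merged into one kernel-verified Lean document; each statement's English description precedes it below -/
import Mathlib

section
/- Fix 1 < α < 2 and set β = 2(1 − 1/α). Let μ_α be the probability measure on ℝ with density c_α e^{−|x|^α} (c_α the normalizing constant), and let μ = μ_α^{⊗N} on ℝ^N. Then there is a constant C > 0, depending only on α, such that for every N ≥ 1 and every smooth function f : ℝ^N → ℝ with |f| ≤ 1, Var_μ(f) ≤ C · Σ_{i=1}^N ‖∂_i f‖₁ (1 + ‖∂_i f‖₁) / [1 + log⁺(1/‖∂_i f‖₁)]^{β/2}. -/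
open MeasureTheory

/-- The probability measure `c e^{-|x|^α} dx` on `ℝ`. -/
noncomputable def expAlphaMeasure (α c : ℝ) : Measure ℝ :=
  volume.withDensity fun x => ENNReal.ofReal (c * Real.exp (-|x| ^ α))

/-- The product measure `(c_α e^{-|x|^α} dx)^{⊗N}` on `ℝ^N`. -/
noncomputable def expAlphaPi (α c : ℝ) (N : ℕ) : Measure (Fin N → ℝ) :=
  Measure.pi fun _ => expAlphaMeasure α c

/-- The `i`-th partial derivative. -/
noncomputable def pderiv (N : ℕ) (i : Fin N) (f : (Fin N → ℝ) → ℝ) (x : Fin N → ℝ) : ℝ :=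
  fderiv ℝ f x (Pi.single i 1)

/-- `L¹(μ)` norm. -/
noncomputable def l1norm {X : Type*} [MeasurableSpace X] (μ : Measure X) (g : X → ℝ) : ℝ :=
  ∫ x, |g x| ∂μ

/-- Variance. -/
noncomputable def var' {X : Type*} [MeasurableSpace X] (μ : Measure X) (f : X → ℝ) : ℝ :=
  (∫ x, f x ^ 2 ∂μ) - (∫ x, f x ∂μ) ^ 2

/-- Average of the two slices of `h` in the first bit. -/
noncomputable def sliceMean {n : ℕ} (h : (Fin (n + 1) → Bool) → ℝ) (x : Fin n → Bool) : ℝ :=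
  (h (Fin.cons true x) + h (Fin.cons false x)) / 2

/-- Half the difference of the two slices of `h` in the first bit. -/
noncomputable def sliceDiff {n : ℕ} (h : (Fin (n + 1) → Bool) → ℝ) (x : Fin n → Bool) : ℝ :=
  (h (Fin.cons true x) - h (Fin.cons false x)) / 2

/-- The bilinear form `∑_S s^|S| ĥ(S) ĝ(S)` on functions on the discrete cube. -/
noncomputable def noiseForm (s : ℝ) :
    (n : ℕ) → ((Fin n → Bool) → ℝ) → ((Fin n → Bool) → ℝ) → ℝ
  | 0, h, g => h default * g default
  | n + 1, h, g => noiseForm s n (sliceMean h) (sliceMean g) +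
      s * noiseForm s n (sliceDiff h) (sliceDiff g)

/-- Expectation under the uniform measure on the discrete cube. -/
noncomputable def cubeAvg {ι : Type*} [Fintype ι] [DecidableEq ι] (h : (ι → Bool) → ℝ) : ℝ :=
  (2⁻¹ : ℝ) ^ Fintype.card ι * ∑ x, h x

/-- Half the discrete derivative in the direction `k`. -/
noncomputable def bitDeriv {ι : Type*} [DecidableEq ι] (k : ι) (h : (ι → Bool) → ℝ)
    (x : ι → Bool) : ℝ :=
  (h (Function.update x k true) - h (Function.update x k false)) / 2

theorem cubeAvg_succ {n : ℕ} (h : (Fin (n + 1) → Bool) → ℝ) :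
    cubeAvg h = (cubeAvg (fun x => h (Fin.cons true x)) +
      cubeAvg (fun x => h (Fin.cons false x))) / 2 := by
  unfold cubeAvg
  rw [← (Fin.consEquiv (fun _ => Bool)).sum_comp, Fintype.sum_prod_type]
  simp [Fin.consEquiv, pow_succ]
  ring

theorem cubeAvg_nonneg {ι : Type*} [Fintype ι] [DecidableEq ι] {h : (ι → Bool) → ℝ}
    (hh : ∀ x, 0 ≤ h x) : 0 ≤ cubeAvg h :=
  mul_nonneg (by positivity) (Finset.sum_nonneg fun x _ => hh x)

theorem cubeAvg_mono {ι : Type*} [Fintype ι] [DecidableEq ι] {h g : (ι → Bool) → ℝ}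
    (hh : ∀ x, h x ≤ g x) : cubeAvg h ≤ cubeAvg g :=
  mul_le_mul_of_nonneg_left (Finset.sum_le_sum fun x _ => hh x) (by positivity)

theorem cubeAvg_const {ι : Type*} [Fintype ι] [DecidableEq ι] (a : ℝ) :
    cubeAvg (fun _ : ι → Bool => a) = a := by
  simp [cubeAvg]

theorem noiseForm_comm (s : ℝ) {n : ℕ} (h g : (Fin n → Bool) → ℝ) :
    noiseForm s n h g = noiseForm s n g h := by
  induction n with
  | zero => simp only [noiseForm]; ring
  | succ n ih => simp only [noiseForm]; rw [ih, ih (sliceDiff h)]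

theorem noiseForm_linear_left (s a b : ℝ) {n : ℕ} (u v g : (Fin n → Bool) → ℝ) :
    noiseForm s n (fun x => a * u x + b * v x) g =
      a * noiseForm s n u g + b * noiseForm s n v g := by
  induction n with
  | zero => simp only [noiseForm]; ring
  | succ n ih =>
    have h1 : sliceMean (fun x => a * u x + b * v x) =
        fun x => a * sliceMean u x + b * sliceMean v x := by
      funext x; simp only [sliceMean]; ring
    have h2 : sliceDiff (fun x => a * u x + b * v x) =
        fun x => a * sliceDiff u x + b * sliceDiff v x := by
      funext x; simp only [sliceDiff]; ring
    simp only [noiseForm]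
    rw [h1, h2, ih, ih]
    ring

theorem noiseForm_linear_self (s a b : ℝ) {n : ℕ} (u v : (Fin n → Bool) → ℝ) :
    noiseForm s n (fun x => a * u x + b * v x) (fun x => a * u x + b * v x) =
      a ^ 2 * noiseForm s n u u + 2 * a * b * noiseForm s n u v + b ^ 2 * noiseForm s n v v := by
  rw [noiseForm_linear_left, noiseForm_comm s u, noiseForm_comm s v, noiseForm_linear_left,
    noiseForm_linear_left, noiseForm_comm s v u]
  ring

theorem noiseForm_self_nonneg {s : ℝ} (hs : 0 ≤ s) {n : ℕ} (h : (Fin n → Bool) → ℝ) :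
    0 ≤ noiseForm s n h h := by
  induction n with
  | zero => exact mul_self_nonneg _
  | succ n ih => exact add_nonneg (ih _) (mul_nonneg hs (ih _))

theorem noiseForm_le_sqrt_mul_sqrt {s : ℝ} (hs : 0 ≤ s) {n : ℕ} (u v : (Fin n → Bool) → ℝ) :
    noiseForm s n u v ≤ √(noiseForm s n u u) * √(noiseForm s n v v) := by
  rw [← Real.sqrt_mul (noiseForm_self_nonneg hs u)]
  apply Real.le_sqrt_of_sq_le
  have key : ∀ t : ℝ, 0 ≤ noiseForm s n v v * (t * t) + 2 * noiseForm s n u v * t +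
      noiseForm s n u u := by
    intro t
    have := noiseForm_self_nonneg hs (fun x => 1 * u x + t * v x)
    rw [noiseForm_linear_self] at this
    linarith
  have := discrim_le_zero key
  unfold discrim at this
  nlinarith

theorem two_mul_le_rpow_sub_rpow {s t : ℝ} (hs0 : 0 ≤ s) (hs1 : s ≤ 1) (ht0 : 0 ≤ t)
    (ht1 : t ≤ 1) : 2 * s * t ≤ (1 + t) ^ s - (1 - t) ^ s := by
  have hd : ∀ u ∈ Set.Ioo (0 : ℝ) 1, HasDerivAt
      (fun u : ℝ => (1 + u) ^ s - (1 - u) ^ s - 2 * s * u)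
      (s * ((1 + u) ^ (s - 1) + (1 - u) ^ (s - 1) - 2)) u := by
    intro u hu
    have h1 := ((hasDerivAt_id u).const_add 1).rpow_const (p := s)
      (Or.inl (by simp only [id]; linarith [hu.1]))
    have h2 := ((hasDerivAt_id u).const_sub 1).rpow_const (p := s)
      (Or.inl (by simp only [id]; linarith [hu.2]))
    have h3 := (hasDerivAt_id u).const_mul (2 * s)
    refine ((h1.sub h2).sub h3).congr_deriv ?_
    simp only [id]
    ring
  have hmono := monotoneOn_of_deriv_nonneg (convex_Icc (0 : ℝ) 1)
    (f := fun u : ℝ => (1 + u) ^ s - (1 - u) ^ s - 2 * s * u)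
    (by
      refine ContinuousOn.sub (ContinuousOn.sub ?_ ?_) (by fun_prop)
      · exact ContinuousOn.rpow_const (by fun_prop) fun _ _ => Or.inr hs0
      · exact ContinuousOn.rpow_const (by fun_prop) fun _ _ => Or.inr hs0)
    (fun u hu => by
      rw [interior_Icc] at hu
      exact (hd u hu).differentiableAt.differentiableWithinAt)
    (fun u hu => by
      rw [interior_Icc] at hu
      rw [(hd u hu).deriv]
      have p1 : 0 < 1 + u := by linarith [hu.1]
      have p2 : 0 < 1 - u := by linarith [hu.2]
      have hprod : 1 ≤ (1 + u) ^ (s - 1) * (1 - u) ^ (s - 1) := by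
        rw [← Real.mul_rpow p1.le p2.le]
        exact Real.one_le_rpow_of_pos_of_le_one_of_nonpos (mul_pos p1 p2)
          (by nlinarith [hu.1]) (by linarith)
      have q1 := Real.rpow_pos_of_pos p1 (s - 1)
      have q2 := Real.rpow_pos_of_pos p2 (s - 1)
      apply mul_nonneg hs0
      nlinarith [sq_nonneg ((1 + u) ^ (s - 1) - (1 - u) ^ (s - 1))])
  have := hmono (Set.left_mem_Icc.2 zero_le_one) ⟨ht0, ht1⟩ ht0
  simp at this
  linarith

theorem one_add_le_rpow_add_rpow {s t : ℝ} (hs0 : 0 ≤ s) (hs1 : s ≤ 1) (ht0 : 0 ≤ t)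
    (ht1 : t ≤ 1) :
    1 + (1 + s) / 2 * (s * t ^ 2) ≤ ((1 + t) ^ (1 + s) + (1 - t) ^ (1 + s)) / 2 := by
  have hd : ∀ u ∈ Set.Ioo (0 : ℝ) 1, HasDerivAt
      (fun u : ℝ => ((1 + u) ^ (1 + s) + (1 - u) ^ (1 + s)) / 2 -
        (1 + s) / 2 * (s * u ^ 2))
      ((1 + s) / 2 * ((1 + u) ^ s - (1 - u) ^ s - 2 * s * u)) u := by
    intro u hu
    have h1 := ((hasDerivAt_id u).const_add 1).rpow_const (p := 1 + s)
      (Or.inl (by simp only [id]; linarith [hu.1]))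
    have h2 := ((hasDerivAt_id u).const_sub 1).rpow_const (p := 1 + s)
      (Or.inl (by simp only [id]; linarith [hu.2]))
    have h3 := (((hasDerivAt_id u).pow 2).const_mul s).const_mul ((1 + s) / 2)
    refine (((h1.add h2).div_const 2).sub h3).congr_deriv ?_
    simp only [id, add_sub_cancel_left]
    ring
  have hmono := monotoneOn_of_deriv_nonneg (convex_Icc (0 : ℝ) 1)
    (f := fun u : ℝ => ((1 + u) ^ (1 + s) + (1 - u) ^ (1 + s)) / 2 -
      (1 + s) / 2 * (s * u ^ 2))
    (by
      refine ContinuousOn.sub (ContinuousOn.div_const (ContinuousOn.add ?_ ?_) 2) (by fun_prop)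
      · exact ContinuousOn.rpow_const (by fun_prop) fun _ _ => Or.inr (by linarith)
      · exact ContinuousOn.rpow_const (by fun_prop) fun _ _ => Or.inr (by linarith))
    (fun u hu => by
      rw [interior_Icc] at hu
      exact (hd u hu).differentiableAt.differentiableWithinAt)
    (fun u hu => by
      rw [interior_Icc] at hu
      rw [(hd u hu).deriv]
      exact mul_nonneg (by linarith)
        (sub_nonneg.2 (two_mul_le_rpow_sub_rpow hs0 hs1 hu.1.le hu.2.le)))
  have := hmono (Set.left_mem_Icc.2 zero_le_one) ⟨ht0, ht1⟩ ht0
  simp at this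
  linarith

/-- The two-point hypercontractive inequality of Bonami. -/
theorem two_point_hypercontractive {s x y : ℝ} (hs0 : 0 ≤ s) (hs1 : s ≤ 1)
    (hx : 0 ≤ x) (hy : 0 ≤ y) :
    (((x + y) / 2) ^ 2 + s * ((x - y) / 2) ^ 2) ^ ((1 + s) / 2) ≤
      (x ^ (1 + s) + y ^ (1 + s)) / 2 := by
  wlog hxy : y ≤ x generalizing x y
  · have := this hy hx (not_le.1 hxy).le
    rwa [add_comm y, ← neg_sub x y, neg_div, neg_sq, add_comm (y ^ (1 + s))] at this
  rcases eq_or_lt_of_le (by positivity : 0 ≤ (x + y) / 2) with ha | ha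
  · obtain rfl : x = 0 := by linarith
    obtain rfl : y = 0 := by linarith
    have h1 : (1 + s) / 2 ≠ 0 := by linarith
    have h2 : 1 + s ≠ 0 := by linarith
    simp [Real.zero_rpow h1, Real.zero_rpow h2]
  set a := (x + y) / 2 with ha_def
  set t := (x - y) / 2 / a with ht_def
  have hta : (x - y) / 2 = a * t := by rw [ht_def]; field_simp
  have ht0 : 0 ≤ t := div_nonneg (by linarith) ha.le
  have ht1 : t ≤ 1 := by rw [ht_def, div_le_one ha]; linarith
  have ex : x = a * (1 + t) := by linarith
  have ey : y = a * (1 - t) := by linarith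
  have e1 : (a ^ 2 + s * (a * t) ^ 2) ^ ((1 + s) / 2) =
      a ^ (1 + s) * (1 + s * t ^ 2) ^ ((1 + s) / 2) := by
    rw [show a ^ 2 + s * (a * t) ^ 2 = a ^ 2 * (1 + s * t ^ 2) by ring,
      Real.mul_rpow (by positivity) (by positivity), ← Real.rpow_natCast a 2,
      ← Real.rpow_mul ha.le]
    congr 2
    push_cast
    ring
  rw [hta, e1, ex, ey, Real.mul_rpow ha.le (by linarith), Real.mul_rpow ha.le (by linarith),
    ← mul_add, mul_div_assoc]
  refine mul_le_mul_of_nonneg_left ?_ (by positivity)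
  refine le_trans ?_ (one_add_le_rpow_add_rpow hs0 hs1 ht0 ht1)
  exact rpow_one_add_le_one_add_mul_self (by nlinarith [mul_nonneg hs0 (sq_nonneg t)])
    (by linarith) (by linarith)

theorem noiseForm_rpow_le {s : ℝ} (hs0 : 0 ≤ s) (hs1 : s ≤ 1) {n : ℕ}
    (h : (Fin n → Bool) → ℝ) :
    noiseForm s n h h ^ ((1 + s) / 2) ≤ cubeAvg (fun x => |h x| ^ (1 + s)) := by
  induction n with
  | zero =>
    simp only [noiseForm, cubeAvg]
    rw [← abs_mul_abs_self, ← pow_two, ← Real.rpow_natCast, ← Real.rpow_mul (abs_nonneg _)]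
    rw [Subsingleton.elim (default : Fin 0 → Bool) fun _ => false,
      show ((2 : ℕ) : ℝ) * ((1 + s) / 2) = 1 + s by push_cast; ring]
    simpa using (congrArg (fun z => |h z| ^ (1 + s)) (Subsingleton.elim _ _)).le
  | succ n ih =>
    set u : (Fin n → Bool) → ℝ := fun x => h (Fin.cons true x) with hu
    set v : (Fin n → Bool) → ℝ := fun x => h (Fin.cons false x) with hv
    have h1 : sliceMean h = fun x => (1 / 2) * u x + (1 / 2) * v x := by
      funext x; simp only [sliceMean, hu, hv]; ring
    have h2 : sliceDiff h = fun x => (1 / 2) * u x + (-1 / 2) * v x := by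
      funext x; simp only [sliceDiff, hu, hv]; ring
    have hQu := noiseForm_self_nonneg hs0 u
    have hQv := noiseForm_self_nonneg hs0 v
    have e1 := Real.sq_sqrt hQu
    have e2 := Real.sq_sqrt hQv
    have pw : ∀ q : ℝ, 0 ≤ q → (√q) ^ (1 + s) = q ^ ((1 + s) / 2) := by
      intro q hq
      rw [Real.sqrt_eq_rpow, ← Real.rpow_mul hq]
      congr 1; ring
    have le1 : noiseForm s (n + 1) h h ≤
        ((√(noiseForm s n u u) + √(noiseForm s n v v)) / 2) ^ 2 +
          s * ((√(noiseForm s n u u) - √(noiseForm s n v v)) / 2) ^ 2 := by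
      simp only [noiseForm]
      rw [h1, h2, noiseForm_linear_self, noiseForm_linear_self]
      have := mul_le_mul_of_nonneg_left (noiseForm_le_sqrt_mul_sqrt hs0 u v)
        (sub_nonneg.2 hs1)
      nlinarith
    calc noiseForm s (n + 1) h h ^ ((1 + s) / 2)
        ≤ _ := Real.rpow_le_rpow (noiseForm_self_nonneg hs0 h) le1 (by linarith)
      _ ≤ _ := two_point_hypercontractive hs0 hs1 (Real.sqrt_nonneg _) (Real.sqrt_nonneg _)
      _ ≤ _ := by
        rw [pw _ hQu, pw _ hQv, cubeAvg_succ]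
        have := ih u
        have := ih v
        simp only [hu, hv] at *
        linarith

theorem bitDeriv_zero_slices {n : ℕ} (h : (Fin (n + 1) → Bool) → ℝ) :
    sliceMean (bitDeriv 0 h) = sliceDiff h ∧ sliceDiff (bitDeriv 0 h) = fun _ => 0 := by
  constructor <;> funext x <;> simp [sliceMean, sliceDiff, bitDeriv, Fin.update_cons_zero]

theorem bitDeriv_succ_slices {n : ℕ} (k : Fin n) (h : (Fin (n + 1) → Bool) → ℝ) :
    sliceMean (bitDeriv k.succ h) = bitDeriv k (sliceMean h) ∧
      sliceDiff (bitDeriv k.succ h) = bitDeriv k (sliceDiff h) := by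
  constructor <;> funext x <;> simp only [sliceMean, sliceDiff, bitDeriv, ← Fin.cons_update] <;>
    ring

theorem noiseForm_zero_left (s : ℝ) {n : ℕ} (g : (Fin n → Bool) → ℝ) :
    noiseForm s n (fun _ => 0) g = 0 := by
  simpa using noiseForm_linear_left s 0 0 g g g

theorem hasDerivAt_noiseForm {n : ℕ} (h : (Fin n → Bool) → ℝ) (s : ℝ) :
    HasDerivAt (fun s => noiseForm s n h h)
      (∑ k, noiseForm s n (bitDeriv k h) (bitDeriv k h)) s := by
  induction n with
  | zero => simpa [noiseForm] using hasDerivAt_const s (h default * h default)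
  | succ n ih =>
    refine ((ih (sliceMean h)).add ((hasDerivAt_id s).mul (ih (sliceDiff h)))).congr_deriv ?_
    rw [Fin.sum_univ_succ]
    simp only [noiseForm, (bitDeriv_zero_slices h).1, (bitDeriv_zero_slices h).2,
      (bitDeriv_succ_slices _ h).1, (bitDeriv_succ_slices _ h).2, noiseForm_zero_left,
      Finset.sum_add_distrib, Finset.mul_sum, id]
    ring

theorem noiseForm_one {n : ℕ} (h : (Fin n → Bool) → ℝ) :
    noiseForm 1 n h h = cubeAvg (fun x => h x ^ 2) := by
  induction n with
  | zero => simp [noiseForm, cubeAvg, pow_two, Unique.eq_default]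
  | succ n ih =>
    simp only [noiseForm]
    rw [ih, ih, cubeAvg_succ]
    simp only [cubeAvg, sliceMean, sliceDiff, one_mul]
    rw [← mul_add, ← mul_add, ← Finset.sum_add_distrib, ← Finset.sum_add_distrib, mul_div_assoc,
      Finset.sum_div]
    congr 1
    exact Finset.sum_congr rfl fun x _ => by ring

theorem noiseForm_zero {n : ℕ} (h : (Fin n → Bool) → ℝ) :
    noiseForm 0 n h h = cubeAvg h ^ 2 := by
  induction n with
  | zero => simp [noiseForm, cubeAvg, pow_two, Unique.eq_default]
  | succ n ih =>
    simp only [noiseForm]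
    rw [ih, cubeAvg_succ]
    simp only [cubeAvg, sliceMean, zero_mul, add_zero]
    rw [← mul_add, ← Finset.sum_add_distrib, mul_div_assoc, Finset.sum_div]

theorem noiseForm_le_of_decay {s M l : ℝ} (hs0 : 0 ≤ s) (hs1 : s ≤ 1) (hM : 1 ≤ M)
    {n : ℕ} {h : (Fin n → Bool) → ℝ} (hh : ∀ x, |h x| ≤ 1)
    (ha : cubeAvg (fun x => |h x|) ≤ M * Real.exp (-l)) :
    noiseForm s n h h ≤
      cubeAvg (fun x => |h x|) * M * Real.exp (-(l * (1 - s) / 2)) := by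
  set a := cubeAvg (fun x => |h x|) with ha_def
  have ha0 : 0 ≤ a := cubeAvg_nonneg fun x => abs_nonneg _
  have ha1 : a ≤ 1 := (cubeAvg_mono hh).trans_eq (cubeAvg_const 1)
  have hQ := noiseForm_self_nonneg hs0 h
  have h1 : noiseForm s n h h ^ ((1 + s) / 2) ≤ a := by
    refine (noiseForm_rpow_le hs0 hs1 h).trans (cubeAvg_mono fun x => ?_)
    calc |h x| ^ (1 + s) ≤ |h x| ^ (1 : ℝ) :=
          Real.rpow_le_rpow_of_exponent_ge' (abs_nonneg _) (hh x) zero_le_one (by linarith)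
      _ = _ := Real.rpow_one _
  have hp : 0 < (1 + s) / 2 := by linarith
  have h2 : noiseForm s n h h ≤ a ^ (2 / (1 + s)) := by
    have := Real.rpow_le_rpow (Real.rpow_nonneg hQ _) h1 (inv_nonneg.2 hp.le)
    rwa [← Real.rpow_mul hQ, mul_inv_cancel₀ hp.ne', Real.rpow_one, inv_div] at this
  have h3 : a ^ (2 / (1 + s)) ≤ a ^ (1 + (1 - s) / 2) := by
    apply Real.rpow_le_rpow_of_exponent_ge' ha0 ha1 (by linarith)
    rw [le_div_iff₀ (by linarith)]
    nlinarith
  have h4 : a ^ (1 + (1 - s) / 2) = a * a ^ ((1 - s) / 2) := by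
    rw [Real.rpow_add_of_nonneg ha0 zero_le_one (by linarith), Real.rpow_one]
  have h5 : a ^ ((1 - s) / 2) ≤ M * Real.exp (-(l * (1 - s) / 2)) := by
    calc a ^ ((1 - s) / 2) ≤ (M * Real.exp (-l)) ^ ((1 - s) / 2) :=
          Real.rpow_le_rpow ha0 ha (by linarith)
      _ = M ^ ((1 - s) / 2) * Real.exp (-(l * (1 - s) / 2)) := by
          rw [Real.mul_rpow (by linarith) (Real.exp_nonneg _), ← Real.exp_mul]
          congr 2; ring
      _ ≤ M * Real.exp (-(l * (1 - s) / 2)) := by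
          gcongr
          calc M ^ ((1 - s) / 2) ≤ M ^ (1 : ℝ) :=
                Real.rpow_le_rpow_of_exponent_le hM (by linarith)
            _ = M := Real.rpow_one M
  calc noiseForm s n h h ≤ a * a ^ ((1 - s) / 2) := h4 ▸ h2.trans h3
    _ ≤ a * (M * Real.exp (-(l * (1 - s) / 2))) := mul_le_mul_of_nonneg_left h5 ha0
    _ = _ := by ring

theorem cube_talagrand_fin {n : ℕ} {M : ℝ} (hM : 1 ≤ M) (l : Fin n → ℝ) (hl : ∀ k, 0 < l k)
    (h : (Fin n → Bool) → ℝ) (hh : ∀ x, |h x| ≤ 1)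
    (ha : ∀ k, cubeAvg (fun x => |bitDeriv k h x|) ≤ M * Real.exp (-l k)) :
    cubeAvg (fun x => h x ^ 2) - cubeAvg h ^ 2 ≤
      ∑ k, 2 * M * cubeAvg (fun x => |bitDeriv k h x|) / l k := by
  have hD : ∀ k x, |bitDeriv k h x| ≤ 1 := by
    intro k x
    have h1 := abs_le.1 (hh (Function.update x k true))
    have h2 := abs_le.1 (hh (Function.update x k false))
    rw [bitDeriv, abs_le]
    constructor <;> linarith
  set a : Fin n → ℝ := fun k => cubeAvg (fun x => |bitDeriv k h x|) with ha_def
  have ha0 : ∀ k, 0 ≤ a k := fun k => cubeAvg_nonneg fun x => abs_nonneg _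
  have hderiv : ∀ s : ℝ, HasDerivAt
      (fun s => (∑ k, 2 * M * a k / l k * Real.exp (-(l k * (1 - s) / 2))) - noiseForm s n h h)
      ((∑ k, a k * M * Real.exp (-(l k * (1 - s) / 2))) -
        ∑ k, noiseForm s n (bitDeriv k h) (bitDeriv k h)) s := by
    intro s
    refine HasDerivAt.sub ?_ (hasDerivAt_noiseForm h s)
    refine HasDerivAt.fun_sum fun k _ => ?_
    have h1 : HasDerivAt (fun s : ℝ => -(l k * (1 - s) / 2)) (l k / 2) s := by
      have := ((((hasDerivAt_id s).const_sub 1).const_mul (l k)).div_const 2).neg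
      exact this.congr_deriv (by ring)
    refine (h1.exp.const_mul (2 * M * a k / l k)).congr_deriv ?_
    have := (hl k).ne'
    field_simp
  have hmono := monotoneOn_of_deriv_nonneg (convex_Icc (0 : ℝ) 1)
    (f := fun s => (∑ k, 2 * M * a k / l k * Real.exp (-(l k * (1 - s) / 2))) -
      noiseForm s n h h)
    (fun s _ => (hderiv s).continuousAt.continuousWithinAt)
    (fun s _ => (hderiv s).differentiableAt.differentiableWithinAt)
    (fun s hs => by
      rw [interior_Icc] at hs
      rw [(hderiv s).deriv, sub_nonneg]
      exact Finset.sum_le_sum fun k _ =>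
        noiseForm_le_of_decay hs.1.le hs.2.le hM (hD k) (ha k))
  have := hmono (Set.left_mem_Icc.2 zero_le_one) (Set.right_mem_Icc.2 zero_le_one) zero_le_one
  simp only [noiseForm_one, noiseForm_zero, sub_self, mul_zero, zero_div, neg_zero, Real.exp_zero,
    mul_one] at this
  have hpos : 0 ≤ ∑ k, 2 * M * a k / l k * Real.exp (-(l k * (1 - 0) / 2)) :=
    Finset.sum_nonneg fun k _ => mul_nonneg
      (div_nonneg (mul_nonneg (by linarith) (ha0 k)) (hl k).le) (Real.exp_nonneg _)
  simp only [sub_zero, mul_one] at hpos this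
  linarith

theorem cubeAvg_comp_equiv {ι κ : Type*} [Fintype ι] [DecidableEq ι] [Fintype κ] [DecidableEq κ]
    (e : ι ≃ κ) (h : (ι → Bool) → ℝ) :
    cubeAvg (fun x : κ → Bool => h (x ∘ e)) = cubeAvg h := by
  unfold cubeAvg
  rw [Fintype.card_congr e, ← (Equiv.arrowCongr e.symm (Equiv.refl Bool)).sum_comp]
  rfl

/-- Talagrand's `L¹`-`L²` inequality on the discrete cube, for functions bounded by one whose
discrete derivatives have small `L¹` norms. -/
theorem cube_talagrand {ι : Type*} [Fintype ι] [DecidableEq ι] {M : ℝ} (hM : 1 ≤ M) (l : ι → ℝ)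
    (hl : ∀ k, 0 < l k) (h : (ι → Bool) → ℝ) (hh : ∀ x, |h x| ≤ 1)
    (ha : ∀ k, cubeAvg (fun x => |bitDeriv k h x|) ≤ M * Real.exp (-l k)) :
    cubeAvg (fun x => h x ^ 2) - cubeAvg h ^ 2 ≤
      ∑ k, 2 * M * cubeAvg (fun x => |bitDeriv k h x|) / l k := by
  set e := Fintype.equivFin ι
  have hb : ∀ k : ι, ∀ x : Fin _ → Bool,
      bitDeriv (e k) (fun x => h (x ∘ e)) x = bitDeriv k h (x ∘ e) := by
    intro k x
    have (b : Bool) : Function.update x (e k) b ∘ e = Function.update (x ∘ e) k b :=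
      Function.update_comp_eq_of_injective _ e.injective _ _
    simp only [bitDeriv, this]
  have ha' : ∀ k, cubeAvg (fun x => |bitDeriv (e k) (fun x => h (x ∘ e)) x|) =
      cubeAvg (fun x => |bitDeriv k h x|) := by
    intro k
    simp only [hb]
    exact cubeAvg_comp_equiv e fun x => |bitDeriv k h x|
  have := cube_talagrand_fin hM (l ∘ e.symm) (fun k => hl _) (fun x => h (x ∘ e))
    (fun x => hh _) (fun k => by
      obtain ⟨k, rfl⟩ := e.surjective k
      rw [ha']
      simpa using ha k)
  rw [cubeAvg_comp_equiv e fun x => h x ^ 2, cubeAvg_comp_equiv e h, ← e.sum_comp] at this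
  simpa [ha'] using this

theorem integrable_of_abs_le_one {Y : Type*} [MeasurableSpace Y] {κ : Measure Y}
    [IsFiniteMeasure κ] {f : Y → ℝ} (hf : Measurable f) (hb : ∀ x, |f x| ≤ 1) :
    Integrable f κ :=
  Integrable.of_bound hf.aestronglyMeasurable 1 (Filter.Eventually.of_forall hb)

section PiMeasure

variable {ι X : Type*} [DecidableEq ι] [MeasurableSpace X]

theorem measurable_update_pair (i : ι) :
    Measurable fun q : (ι → X) × X => Function.update q.1 i q.2 := by
  refine measurable_pi_lambda _ fun k => ?_
  by_cases hk : k = i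
  · subst hk; simpa using measurable_snd
  · simpa [hk] using measurable_fst.eval

theorem measurable_piecewise_pair (S : Finset ι) :
    Measurable fun q : (ι → X) × (ι → X) => S.piecewise q.1 q.2 := by
  refine measurable_pi_lambda _ fun k => ?_
  by_cases hk : k ∈ S
  · simpa [hk] using measurable_fst.eval
  · simpa [hk] using measurable_snd.eval

theorem measurable_enorm_update_sub {f : (ι → X) → ℝ} (hf : Measurable f) (i : ι) :
    Measurable fun q : ((ι → X) × X) × X =>
      ‖f (Function.update q.1.1 i q.1.2) - f (Function.update q.1.1 i q.2)‖ₑ := by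
  have h1 : Measurable fun q : ((ι → X) × X) × X => Function.update q.1.1 i q.1.2 :=
    (measurable_update_pair i).comp measurable_fst
  have h2 : Measurable fun q : ((ι → X) × X) × X => Function.update q.1.1 i q.2 :=
    (measurable_update_pair i).comp
      (((measurable_fst.comp measurable_fst)).prodMk measurable_snd)
  exact ((hf.comp h1).sub (hf.comp h2)).enorm

theorem measurable_lintegral_update_sub {f : (ι → X) → ℝ} (hf : Measurable f) (i : ι)
    (ρ τ : Measure X) [SFinite ρ] [SFinite τ] :
    Measurable fun z : ι → X => ∫⁻ s, ∫⁻ t,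
      ‖f (Function.update z i s) - f (Function.update z i t)‖ₑ ∂τ ∂ρ :=
  (measurable_enorm_update_sub hf i).lintegral_prod_right'.lintegral_prod_right'

variable [Fintype ι]

theorem map_update_pi_prod (m : ι → Measure X) [∀ i, IsProbabilityMeasure (m i)] (i : ι)
    (ρ : Measure X) [IsProbabilityMeasure ρ] :
    ((Measure.pi m).prod ρ).map (fun q : (ι → X) × X => Function.update q.1 i q.2) =
      Measure.pi (Function.update m i ρ) := by
  have : ∀ k, IsProbabilityMeasure (Function.update m i ρ k) := by
    intro k
    by_cases hk : k = i
    · subst hk; simpa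
    · simp only [Function.update_of_ne hk]; infer_instance
  refine (Measure.pi_eq fun s hs => ?_).symm
  rw [Measure.map_apply (measurable_update_pair i) (MeasurableSet.univ_pi hs)]
  have : (fun q : (ι → X) × X => Function.update q.1 i q.2) ⁻¹' Set.univ.pi s =
      (Set.univ.pi (Function.update s i Set.univ)) ×ˢ s i := by
    ext ⟨z, t⟩
    simp only [Set.mem_preimage, Set.mem_pi, Set.mem_univ, true_imp_iff, Set.mem_prod]
    constructor
    · intro h
      refine ⟨fun k => ?_, by simpa using h i⟩
      by_cases hk : k = i
      · subst hk; simp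
      · simpa [hk] using h k
    · rintro ⟨h1, h2⟩ k
      by_cases hk : k = i
      · subst hk; simpa using h2
      · simpa [hk] using h1 k
  rw [this, Measure.prod_prod, Measure.pi_pi, ← Finset.prod_erase_mul _ _ (Finset.mem_univ i),
    ← Finset.prod_erase_mul (s := Finset.univ) (a := i) (f := fun k => Function.update m i ρ k (s k))
      (h := Finset.mem_univ i)]
  simp only [Function.update_self, measure_univ, mul_one]
  congr 1
  refine Finset.prod_congr rfl fun k hk => ?_
  simp [Finset.ne_of_mem_erase hk]

theorem lintegral_pi_update (m : ι → Measure X) [∀ i, IsProbabilityMeasure (m i)] (i : ι)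
    (ρ : Measure X) [IsProbabilityMeasure ρ] {F : (ι → X) → ENNReal} (hF : Measurable F) :
    ∫⁻ z, F z ∂Measure.pi (Function.update m i ρ) =
      ∫⁻ z, ∫⁻ t, F (Function.update z i t) ∂ρ ∂Measure.pi m := by
  rw [← map_update_pi_prod, lintegral_map hF (measurable_update_pair i), lintegral_prod]
  exact (hF.comp (measurable_update_pair i)).aemeasurable

theorem lintegral_pi_update_self (m : ι → Measure X) [∀ i, IsProbabilityMeasure (m i)] (i : ι)
    {F : (ι → X) → ENNReal} (hF : Measurable F) :
    ∫⁻ z, ∫⁻ t, F (Function.update z i t) ∂(m i) ∂Measure.pi m = ∫⁻ z, F z ∂Measure.pi m := by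
  rw [← lintegral_pi_update m i (m i) hF, Function.update_eq_self]

theorem map_piecewise_pi_prod (m : ι → Measure X) [∀ i, IsProbabilityMeasure (m i)]
    (S : Finset ι) :
    ((Measure.pi m).prod (Measure.pi m)).map
      (fun q : (ι → X) × (ι → X) => S.piecewise q.1 q.2) = Measure.pi m := by
  refine (Measure.pi_eq fun s hs => ?_).symm
  rw [Measure.map_apply (measurable_piecewise_pair S) (MeasurableSet.univ_pi hs)]
  have : (fun q : (ι → X) × (ι → X) => S.piecewise q.1 q.2) ⁻¹' Set.univ.pi s =
      (Set.univ.pi (S.piecewise s fun _ => Set.univ)) ×ˢ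
        (Set.univ.pi (S.piecewise (fun _ => Set.univ) s)) := by
    ext ⟨y, x⟩
    simp only [Set.mem_preimage, Set.mem_pi, Set.mem_univ, true_imp_iff, Set.mem_prod]
    rw [← forall_and]
    refine forall_congr' fun k => ?_
    by_cases hk : k ∈ S <;> simp [hk]
  rw [this, Measure.prod_prod, Measure.pi_pi, Measure.pi_pi, ← Finset.prod_mul_distrib]
  refine Finset.prod_congr rfl fun k _ => ?_
  by_cases hk : k ∈ S <;> simp [hk]

theorem lintegral_update_sub_eq (m : ι → Measure X) [∀ i, IsProbabilityMeasure (m i)]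
    {f : (ι → X) → ℝ} (hf : Measurable f) (i : ι) (ρ : Measure X) [IsProbabilityMeasure ρ] :
    ∫⁻ z, ∫⁻ t, ‖f z - f (Function.update z i t)‖ₑ ∂ρ ∂Measure.pi m =
      ∫⁻ z, ∫⁻ s, ∫⁻ t, ‖f (Function.update z i s) - f (Function.update z i t)‖ₑ
        ∂ρ ∂(m i) ∂Measure.pi m := by
  have hmeas : Measurable fun z : ι → X => ∫⁻ t, ‖f z - f (Function.update z i t)‖ₑ ∂ρ := by
    refine Measurable.lintegral_prod_right'
      (f := fun q : (ι → X) × X => ‖f q.1 - f (Function.update q.1 i q.2)‖ₑ) ?_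
    exact ((hf.comp measurable_fst).sub (hf.comp (measurable_update_pair i))).enorm
  rw [← lintegral_pi_update_self m i hmeas]
  simp only [Function.update_idem]

theorem lintegral_sub_piecewise_le (m : ι → Measure X) [∀ i, IsProbabilityMeasure (m i)]
    {f : (ι → X) → ℝ} (hf : Measurable f) (S : Finset ι) :
    ∫⁻ x, ∫⁻ y, ‖f x - f (S.piecewise y x)‖ₑ ∂Measure.pi m ∂Measure.pi m ≤
      ∑ i ∈ S, ∫⁻ z, ∫⁻ s, ∫⁻ t, ‖f (Function.update z i s) - f (Function.update z i t)‖ₑ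
        ∂(m i) ∂(m i) ∂Measure.pi m := by
  have hpw : ∀ S : Finset ι, Measurable fun q : (ι → X) × (ι → X) => S.piecewise q.2 q.1 :=
    fun S => (measurable_piecewise_pair S).comp measurable_swap
  induction S using Finset.induction_on with
  | empty => simp
  | insert i S hi ih =>
    rw [Finset.sum_insert hi, add_comm]
    have hmG : Measurable fun z : ι → X => ∫⁻ t, ‖f z - f (Function.update z i t)‖ₑ ∂(m i) := by
      refine Measurable.lintegral_prod_right'
        (f := fun q : (ι → X) × X => ‖f q.1 - f (Function.update q.1 i q.2)‖ₑ) ?_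
      exact ((hf.comp measurable_fst).sub (hf.comp (measurable_update_pair i))).enorm
    have hstep : ∫⁻ x, ∫⁻ y, ‖f (S.piecewise y x) - f ((insert i S).piecewise y x)‖ₑ
        ∂Measure.pi m ∂Measure.pi m =
        ∫⁻ z, ∫⁻ t, ‖f z - f (Function.update z i t)‖ₑ ∂(m i) ∂Measure.pi m := by
      have h1 : ∀ x, ∫⁻ y, ‖f (S.piecewise y x) - f ((insert i S).piecewise y x)‖ₑ
          ∂Measure.pi m = ∫⁻ y, ∫⁻ t, ‖f (S.piecewise y x) -
            f (Function.update (S.piecewise y x) i t)‖ₑ ∂(m i) ∂Measure.pi m := by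
        intro x
        have hx : ∀ S : Finset ι, Measurable fun y : ι → X => S.piecewise y x :=
          fun S => (hpw S).comp measurable_prodMk_left
        rw [← lintegral_pi_update_self m i
          (F := fun y => ‖f (S.piecewise y x) - f ((insert i S).piecewise y x)‖ₑ)
          (((hf.comp (hx S)).sub (hf.comp (hx (insert i S)))).enorm)]
        refine lintegral_congr fun y => lintegral_congr fun t => ?_
        have e1 : S.piecewise (Function.update y i t) x = S.piecewise y x := by
          funext k
          by_cases hk : k ∈ S
          · have : k ≠ i := fun h => hi (h ▸ hk)
            simp [hk, this]
          · simp [hk]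
        simp only [Finset.piecewise_insert, e1, Function.update_self]
      simp only [h1]
      rw [← lintegral_prod_symm (f := fun q : (ι → X) × (ι → X) =>
          ∫⁻ t, ‖f (S.piecewise q.1 q.2) - f (Function.update (S.piecewise q.1 q.2) i t)‖ₑ ∂(m i))
          (hmG.comp (measurable_piecewise_pair S)).aemeasurable]
      conv_rhs => rw [← map_piecewise_pi_prod m S,
        lintegral_map hmG (measurable_piecewise_pair S)]
    rw [← lintegral_update_sub_eq m hf i, ← hstep]
    refine le_trans ?_ (add_le_add_left ih _)
    have hm1 : Measurable fun q : (ι → X) × (ι → X) => ‖f q.1 - f (S.piecewise q.2 q.1)‖ₑ :=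
      ((hf.comp measurable_fst).sub (hf.comp (hpw S))).enorm
    rw [← lintegral_add_left hm1.lintegral_prod_right']
    refine lintegral_mono fun x => ?_
    rw [← lintegral_add_left (f := fun y => ‖f (x, y).1 - f (S.piecewise (x, y).2 (x, y).1)‖ₑ)
      (hm1.comp measurable_prodMk_left)]
    refine lintegral_mono fun y => ?_
    simpa using enorm_add_le (f x - f (S.piecewise y x))
      (f (S.piecewise y x) - f ((insert i S).piecewise y x))

/-- An `L¹` Efron–Stein inequality for product measures. -/
theorem lintegral_sub_le_sum (m : ι → Measure X) [∀ i, IsProbabilityMeasure (m i)]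
    {f : (ι → X) → ℝ} (hf : Measurable f) :
    ∫⁻ x, ∫⁻ y, ‖f x - f y‖ₑ ∂Measure.pi m ∂Measure.pi m ≤
      ∑ i, ∫⁻ z, ∫⁻ s, ∫⁻ t, ‖f (Function.update z i s) - f (Function.update z i t)‖ₑ
        ∂(m i) ∂(m i) ∂Measure.pi m := by
  simpa using lintegral_sub_piecewise_le m hf Finset.univ

theorem enorm_integral_sub_pi_update_le (m : ι → Measure X) [∀ i, IsProbabilityMeasure (m i)]
    {f : (ι → X) → ℝ} (hf : Measurable f) (hb : ∀ x, |f x| ≤ 1) (i : ι)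
    (ρ : Measure X) [IsProbabilityMeasure ρ] :
    ‖∫ x, f x ∂Measure.pi m - ∫ x, f x ∂Measure.pi (Function.update m i ρ)‖ₑ ≤
      ∫⁻ z, ∫⁻ s, ∫⁻ t, ‖f (Function.update z i s) - f (Function.update z i t)‖ₑ
        ∂ρ ∂(m i) ∂Measure.pi m := by
  have hfi : Integrable f (Measure.pi m) := integrable_of_abs_le_one hf hb
  have hfu : Integrable (fun q : (ι → X) × X => f (Function.update q.1 i q.2))
      ((Measure.pi m).prod ρ) :=
    integrable_of_abs_le_one (hf.comp (measurable_update_pair i)) fun _ => hb _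
  rw [← lintegral_update_sub_eq m hf i ρ, ← map_update_pi_prod m i ρ,
    integral_map (measurable_update_pair i).aemeasurable hf.aestronglyMeasurable,
    integral_prod _ hfu, ← integral_sub hfi hfu.integral_prod_left]
  refine (enorm_integral_le_lintegral_enorm _).trans (lintegral_mono fun z => ?_)
  have hz : Integrable (fun t => f (Function.update z i t)) ρ :=
    integrable_of_abs_le_one (hf.comp ((measurable_update_pair i).comp measurable_prodMk_left))
      fun _ => hb _
  have : f z - ∫ t, f (Function.update z i t) ∂ρ =
      ∫ t, (f z - f (Function.update z i t)) ∂ρ := by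
    rw [integral_sub (integrable_const _) hz]
    simp
  simp only [this]
  exact enorm_integral_le_lintegral_enorm _

theorem ofReal_variance_le_lintegral_sub {Y : Type*} [MeasurableSpace Y] (κ : Measure Y)
    [IsProbabilityMeasure κ] {f : Y → ℝ} (hf : Measurable f) (hb : ∀ x, |f x| ≤ 1) :
    ENNReal.ofReal (∫ x, f x ^ 2 ∂κ - (∫ x, f x ∂κ) ^ 2) ≤
      ∫⁻ x, ∫⁻ y, ‖f x - f y‖ₑ ∂κ ∂κ := by
  have hint : Integrable f κ := integrable_of_abs_le_one hf hb
  have hsq : Integrable (fun x => f x ^ 2) κ :=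
    integrable_of_abs_le_one (hf.pow_const 2) fun x => by
      rw [abs_pow]
      exact pow_le_one₀ (abs_nonneg _) (hb x)
  have e : ∫ x, f x ^ 2 ∂κ - (∫ x, f x ∂κ) ^ 2 = ∫ x, f x * (∫ y, (f x - f y) ∂κ) ∂κ := by
    have : ∀ x, ∫ y, (f x - f y) ∂κ = f x - ∫ y, f y ∂κ := by
      intro x
      rw [integral_sub (integrable_const _) hint]
      simp
    simp only [this, mul_sub]
    rw [integral_sub (by simpa only [pow_two] using hsq) (hint.mul_const _), integral_mul_const,
      pow_two (∫ x, f x ∂κ)]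
    simp only [pow_two]
  rw [e]
  calc ENNReal.ofReal (∫ x, f x * (∫ y, (f x - f y) ∂κ) ∂κ)
      ≤ ‖∫ x, f x * (∫ y, (f x - f y) ∂κ) ∂κ‖ₑ := by
        rw [Real.enorm_eq_ofReal_abs]
        exact ENNReal.ofReal_le_ofReal (le_abs_self _)
    _ ≤ ∫⁻ x, ‖f x * (∫ y, (f x - f y) ∂κ)‖ₑ ∂κ := enorm_integral_le_lintegral_enorm _
    _ ≤ _ := lintegral_mono fun x => by
        rw [enorm_mul]
        calc ‖f x‖ₑ * ‖∫ y, (f x - f y) ∂κ‖ₑ ≤ 1 * ‖∫ y, (f x - f y) ∂κ‖ₑ := by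
              gcongr
              rw [Real.enorm_eq_ofReal_abs]
              exact ENNReal.ofReal_le_one.2 (hb x)
          _ ≤ _ := by
              rw [one_mul]
              exact enorm_integral_le_lintegral_enorm _

/-- A product of mixtures is the mixture of the products. -/
theorem pi_mixture {κ : ι → Type*} [∀ i, Fintype (κ i)] (w : ι → ENNReal)
    (m : ∀ i, κ i → Measure X) (ν : ι → Measure X) [∀ i, IsProbabilityMeasure (ν i)]
    [∀ i c, IsProbabilityMeasure (m i c)] (hν : ∀ i, ν i = w i • ∑ c, m i c) :
    Measure.pi ν = (∏ i, w i) • ∑ b : ∀ i, κ i, Measure.pi fun i => m i (b i) := by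
  refine Measure.pi_eq fun s hs => ?_
  simp only [Measure.smul_apply, Measure.finsetSum_apply, Measure.pi_pi, smul_eq_mul, hν,
    Finset.prod_mul_distrib]
  rw [Finset.prod_univ_sum, Fintype.piFinset_univ]

theorem lintegral_pi_mixture_of_update_eq {κ : ι → Type*} [∀ i, Fintype (κ i)]
    (w : ι → ENNReal) (m : ∀ i, κ i → Measure X) (ν : ι → Measure X)
    [∀ i, IsProbabilityMeasure (ν i)] [∀ i c, IsProbabilityMeasure (m i c)]
    (hν : ∀ i, ν i = w i • ∑ c, m i c) (i : ι) (hw : w i * Fintype.card (κ i) = 1)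
    (Φ : κ i → (ι → X) → ENNReal) (hm : ∀ c, Measurable (Φ c))
    (hΦ : ∀ c z t, Φ c (Function.update z i t) = Φ c z) :
    (∏ i, w i) * ∑ b : ∀ i, κ i, ∫⁻ z, Φ (b i) z ∂(Measure.pi fun i => m i (b i)) =
      ∫⁻ z, w i * ∑ c, Φ c z ∂Measure.pi ν := by
  classical
  have hinv : ∀ (b : ∀ i, κ i) (c c' : κ i),
      ∫⁻ z, Φ c' z ∂(Measure.pi fun k => m k (Function.update b i c k)) =
        ∫⁻ z, Φ c' z ∂(Measure.pi fun k => m k (b k)) := by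
    intro b c c'
    have : (fun k => m k (Function.update b i c k)) =
        Function.update (fun k => m k (b k)) i (m i c) := by
      funext k
      by_cases hk : k = i
      · subst hk; simp
      · simp [hk]
    rw [this, lintegral_pi_update _ _ _ (hm c')]
    simp [hΦ]
  let e : (∀ i, κ i) × κ i ≃ (∀ i, κ i) × κ i :=
    { toFun := fun q => (Function.update q.1 i q.2, q.1 i)
      invFun := fun q => (Function.update q.1 i q.2, q.1 i)
      left_inv := fun q => by simp
      right_inv := fun q => by simp }
  have hsum : ∑ b : ∀ i, κ i, ∑ c, ∫⁻ z, Φ c z ∂(Measure.pi fun k => m k (b k)) =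
      Fintype.card (κ i) *
        ∑ b : ∀ i, κ i, ∫⁻ z, Φ (b i) z ∂(Measure.pi fun k => m k (b k)) := by
    rw [← Fintype.sum_prod_type'
      (f := fun (b : ∀ i, κ i) (c : κ i) => ∫⁻ z, Φ c z ∂(Measure.pi fun k => m k (b k))), ← e.sum_comp,
      Fintype.sum_prod_type]
    simp [e, hinv, Finset.mul_sum]
  rw [lintegral_const_mul _ (Finset.measurable_sum _ fun c _ => hm c), pi_mixture w m ν hν,
    lintegral_smul_measure, lintegral_finsetSum_measure, smul_eq_mul]
  simp only [lintegral_finsetSum _ fun c _ => hm c]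
  rw [hsum, mul_left_comm, ← mul_assoc (w i), hw, one_mul]

end PiMeasure

theorem enorm_sub_le_lintegral_uIoc {h h' : ℝ → ℝ} (hd : ∀ x, HasDerivAt h (h' x) x)
    (hc : Continuous h') (s t : ℝ) :
    ‖h s - h t‖ₑ ≤ ∫⁻ z, (Set.uIoc s t).indicator (fun z => ‖h' z‖ₑ) z := by
  rw [lintegral_indicator measurableSet_uIoc, ← enorm_neg, neg_sub,
    ← intervalIntegral.integral_eq_sub_of_hasDerivAt (fun x _ => hd x)
      (hc.intervalIntegrable _ _)]
  have := intervalIntegral.norm_intervalIntegral_eq h' s t volume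
  rw [← ofReal_norm, this, ofReal_norm]
  exact enorm_integral_le_lintegral_enorm _

theorem lintegral_coupling_le_lintegral_deriv {h h' : ℝ → ℝ}
    (hd : ∀ x, HasDerivAt h (h' x) x) (hc : Continuous h') (θ : Measure (ℝ × ℝ)) [SFinite θ] :
    ∫⁻ p, ‖h p.1 - h p.2‖ₑ ∂θ ≤ ∫⁻ z, ‖h' z‖ₑ * θ {p | z ∈ Set.uIoc p.1 p.2} := by
  have hS : MeasurableSet {q : (ℝ × ℝ) × ℝ | q.2 ∈ Set.uIoc q.1.1 q.1.2} := by
    simp only [Set.uIoc, Set.mem_Ioc]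
    exact (measurableSet_lt (f := fun q : (ℝ × ℝ) × ℝ => min q.1.1 q.1.2)
      (by fun_prop) measurable_snd).inter
      (measurableSet_le (g := fun q : (ℝ × ℝ) × ℝ => max q.1.1 q.1.2)
        measurable_snd (by fun_prop))
  calc ∫⁻ p, ‖h p.1 - h p.2‖ₑ ∂θ
      ≤ ∫⁻ p, (∫⁻ z, (Set.uIoc p.1 p.2).indicator (fun z => ‖h' z‖ₑ) z) ∂θ :=
        lintegral_mono fun p => enorm_sub_le_lintegral_uIoc hd hc _ _
    _ = ∫⁻ z, ∫⁻ p : ℝ × ℝ, (Set.uIoc p.1 p.2).indicator (fun z => ‖h' z‖ₑ) z ∂θ := by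
        refine lintegral_lintegral_swap (Measurable.aemeasurable ?_)
        have : (fun q : (ℝ × ℝ) × ℝ =>
            (Set.uIoc q.1.1 q.1.2).indicator (fun z => ‖h' z‖ₑ) q.2) =
            {q : (ℝ × ℝ) × ℝ | q.2 ∈ Set.uIoc q.1.1 q.1.2}.indicator fun q => ‖h' q.2‖ₑ := by
          funext q
          rfl
        change Measurable fun q : (ℝ × ℝ) × ℝ =>
            (Set.uIoc q.1.1 q.1.2).indicator (fun z => ‖h' z‖ₑ) q.2
        rw [this]
        exact (hc.measurable.comp measurable_snd).enorm.indicator hS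
    _ = ∫⁻ z, ‖h' z‖ₑ * θ {p | z ∈ Set.uIoc p.1 p.2} := by
        refine lintegral_congr fun z => ?_
        have : ∀ p : ℝ × ℝ, (Set.uIoc p.1 p.2).indicator (fun z => ‖h' z‖ₑ) z =
            {p : ℝ × ℝ | z ∈ Set.uIoc p.1 p.2}.indicator (fun _ => ‖h' z‖ₑ) p := by
          intro p
          rfl
        simp only [this]
        exact lintegral_indicator_const (hS.preimage measurable_prodMk_right) _

/-- If a coupling of `ν` with itself only pairs points of the same level, then it rarely
separates a given point `z`. -/
theorem coupling_separates_le {ν : Measure ℝ} {θ : Measure (ℝ × ℝ)}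
    (h1 : θ.map Prod.fst = ν) (h2 : θ.map Prod.snd = ν) {L : ℝ → ℕ} (hL : Monotone L)
    (hθ : ∀ᵐ p ∂θ, L p.1 = L p.2) (z : ℝ) :
    θ {p | z ∈ Set.uIoc p.1 p.2} ≤
      2 * min (ν {x | L x = L z}) (min (ν (Set.Iic z)) (ν (Set.Ici z))) := by
  have hLm : MeasurableSet {x | L x = L z} := hL.measurable (measurableSet_singleton (L z))
  have f1 : ∀ s : Set ℝ, MeasurableSet s → θ (Prod.fst ⁻¹' s) = ν s := fun s hs => by
    rw [← h1, Measure.map_apply measurable_fst hs]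
  have f2 : ∀ s : Set ℝ, MeasurableSet s → θ (Prod.snd ⁻¹' s) = ν s := fun s hs => by
    rw [← h2, Measure.map_apply measurable_snd hs]
  have hsub : θ {p | z ∈ Set.uIoc p.1 p.2} ≤
      θ ({p | L p.1 = L z ∧ p.1 ≤ z ∧ z ≤ p.2} ∪ {p | L p.1 = L z ∧ p.2 ≤ z ∧ z ≤ p.1}) := by
    refine measure_mono_ae ?_
    filter_upwards [hθ] with p hp hz
    rcases Set.mem_uIoc.1 hz with ⟨a, b⟩ | ⟨a, b⟩
    · exact Or.inl ⟨le_antisymm (hL a.le) (hp ▸ hL b), a.le, b⟩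
    · exact Or.inr ⟨le_antisymm (hp ▸ hL a.le) (hL b), a.le, b⟩
  refine hsub.trans ((measure_union_le _ _).trans ?_)
  rw [two_mul]
  refine add_le_add (le_min ?_ (le_min ?_ ?_)) (le_min ?_ (le_min ?_ ?_))
  · exact (measure_mono fun p hp => hp.1).trans_eq (f1 _ hLm)
  · exact (measure_mono fun p hp => hp.2.1).trans_eq (f1 _ measurableSet_Iic)
  · exact (measure_mono fun p hp => hp.2.2).trans_eq (f2 _ measurableSet_Ici)
  · exact (measure_mono fun p hp => hp.1).trans_eq (f1 _ hLm)
  · exact (measure_mono fun p hp => hp.2.1).trans_eq (f2 _ measurableSet_Iic)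
  · exact (measure_mono fun p hp => hp.2.2).trans_eq (f1 _ measurableSet_Ici)

theorem lintegral_coupling_le {ρ : ℝ → ENNReal} (hρ : Measurable ρ) {ν : Measure ℝ}
    (hν : ν = volume.withDensity ρ) {θ : Measure (ℝ × ℝ)} [SFinite θ]
    (h1 : θ.map Prod.fst = ν) (h2 : θ.map Prod.snd = ν) {L : ℝ → ℕ} (hL : Monotone L)
    (hθ : ∀ᵐ p ∂θ, L p.1 = L p.2) {D : ENNReal}
    (hD : ∀ z, min (ν {x | L x = L z}) (min (ν (Set.Iic z)) (ν (Set.Ici z))) ≤ D * ρ z)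
    {h h' : ℝ → ℝ} (hd : ∀ x, HasDerivAt h (h' x) x) (hc : Continuous h') :
    ∫⁻ p, ‖h p.1 - h p.2‖ₑ ∂θ ≤ 2 * D * ∫⁻ z, ‖h' z‖ₑ ∂ν := by
  refine (lintegral_coupling_le_lintegral_deriv hd hc θ).trans ?_
  have hm : Measurable fun z => ‖h' z‖ₑ := hc.measurable.enorm
  rw [hν, lintegral_withDensity_eq_lintegral_mul _ hρ hm,
    ← lintegral_const_mul _ (hρ.mul hm)]
  refine lintegral_mono fun z => ?_
  calc ‖h' z‖ₑ * θ {p | z ∈ Set.uIoc p.1 p.2}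
      ≤ ‖h' z‖ₑ * (2 * (D * ρ z)) := by
        gcongr
        exact (coupling_separates_le h1 h2 hL hθ z).trans (by gcongr; exact hD z)
    _ = _ := by simp only [Pi.mul_apply]; ring

section DyadicCells

variable (ν : Measure ℝ)

/-- The index of the dyadic quantile interval of generation `j` that contains `x`. -/
noncomputable def quantileLevel (j : ℕ) (x : ℝ) : ℕ := ⌊2 ^ j * ProbabilityTheory.cdf ν x⌋₊

theorem quantileLevel_monotone (j : ℕ) : Monotone (quantileLevel ν j) := fun x y hxy =>
  Nat.floor_mono (mul_le_mul_of_nonneg_left (ProbabilityTheory.monotone_cdf ν hxy) (by positivity))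

theorem quantileLevel_eq_div {j K : ℕ} (h : j ≤ K) (x : ℝ) :
    quantileLevel ν j x = quantileLevel ν K x / 2 ^ (K - j) := by
  unfold quantileLevel
  have : (2 : ℝ) ^ j * ProbabilityTheory.cdf ν x =
      2 ^ K * ProbabilityTheory.cdf ν x / ((2 ^ (K - j) : ℕ) : ℝ) := by
    rw [eq_div_iff (by positivity)]
    push_cast
    rw [mul_right_comm, ← pow_add, Nat.add_sub_cancel' h]
  rw [this, Nat.floor_div_natCast]

theorem quantileLevel_preimage_eq (j m : ℕ) :
    {x | quantileLevel ν j x = m} = {x | ProbabilityTheory.cdf ν x < (m + 1) / 2 ^ j} \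
      {x | ProbabilityTheory.cdf ν x < m / 2 ^ j} := by
  ext x
  have h2 : (0 : ℝ) < 2 ^ j := by positivity
  have h0 : 0 ≤ 2 ^ j * ProbabilityTheory.cdf ν x :=
    mul_nonneg h2.le (ProbabilityTheory.cdf_nonneg ν x)
  change ⌊2 ^ j * ProbabilityTheory.cdf ν x⌋₊ = m ↔
    ProbabilityTheory.cdf ν x < (m + 1) / 2 ^ j ∧ ¬ ProbabilityTheory.cdf ν x < m / 2 ^ j
  rw [Nat.floor_eq_iff h0, not_lt, lt_div_iff₀' h2, div_le_iff₀' h2, and_comm]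

theorem measurableSet_cdf_lt (b : ℝ) : MeasurableSet {x | ProbabilityTheory.cdf ν x < b} :=
  measurableSet_lt (ProbabilityTheory.monotone_cdf ν).measurable measurable_const

theorem quantileLevel_lt_of_cdf_lt {j : ℕ} {x : ℝ} (hx : ProbabilityTheory.cdf ν x < 1) :
    quantileLevel ν j x < 2 ^ j := by
  unfold quantileLevel
  rw [Nat.floor_lt' (by positivity)]
  push_cast
  exact mul_lt_of_lt_one_right (by positivity) hx

theorem measurableSet_quantileLevel_eq (j m : ℕ) :
    MeasurableSet {x | quantileLevel ν j x = m} :=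
  (quantileLevel_monotone ν j).measurable (measurableSet_singleton m)

/-- The measure `ν` conditioned on the dyadic quantile interval with binary digits `c`. -/
noncomputable def cellMeasure (K : ℕ) (c : Fin K → Bool) : Measure ℝ :=
  (2 ^ K : ENNReal) • ν.restrict {x | quantileLevel ν K x = Nat.ofBits c}

theorem ae_quantileLevel_cellMeasure (K : ℕ) (c : Fin K → Bool) :
    ∀ᵐ x ∂cellMeasure ν K c, quantileLevel ν K x = Nat.ofBits c :=
  Measure.ae_smul_measure (ae_restrict_mem (measurableSet_quantileLevel_eq ν K _)) _

/-- The coupling of `ν` with itself which draws a random dyadic cell `c` and then independent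
points in the cells `c` and `σ c`. -/
noncomputable def cellCoupling (K : ℕ) (σ : (Fin K → Bool) → (Fin K → Bool)) :
    Measure (ℝ × ℝ) :=
  (2 ^ K : ENNReal)⁻¹ • ∑ c, (cellMeasure ν K c).prod (cellMeasure ν K (σ c))

theorem ae_quantileLevel_cellCoupling {j K : ℕ} (hj : j ≤ K)
    {σ : (Fin K → Bool) → (Fin K → Bool)}
    (hσ : ∀ c, Nat.ofBits (σ c) / 2 ^ (K - j) = Nat.ofBits c / 2 ^ (K - j)) :
    ∀ᵐ p ∂cellCoupling ν K σ, quantileLevel ν j p.1 = quantileLevel ν j p.2 := by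
  refine Measure.ae_smul_measure ?_ _
  rw [← Measure.sum_fintype, Measure.ae_sum_iff]
  intro c
  filter_upwards [Measure.quasiMeasurePreserving_fst.ae (ae_quantileLevel_cellMeasure ν K c),
    Measure.quasiMeasurePreserving_snd.ae (ae_quantileLevel_cellMeasure ν K (σ c))] with p h1 h2
  rw [quantileLevel_eq_div ν hj, quantileLevel_eq_div ν hj, h1, h2, hσ]

variable [IsProbabilityMeasure ν] [NullSingletonClass ν]

theorem continuous_cdf : Continuous (ProbabilityTheory.cdf ν) := by
  refine continuous_iff_continuousAt.2 fun x => ?_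
  rw [(ProbabilityTheory.monotone_cdf ν).continuousAt_iff_leftLim_eq_rightLim,
    StieltjesFunction.rightLim_eq]
  have h := (ProbabilityTheory.cdf ν).measure_singleton x
  rw [ProbabilityTheory.measure_cdf, measure_singleton, eq_comm, ENNReal.ofReal_eq_zero] at h
  exact le_antisymm ((ProbabilityTheory.monotone_cdf ν).leftLim_le le_rfl) (by linarith)

theorem exists_cdf_eq {b : ℝ} (h0 : 0 < b) (h1 : b < 1) : ∃ x, ProbabilityTheory.cdf ν x = b :=
  mem_range_of_exists_le_of_exists_ge (continuous_cdf ν)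
    (((ProbabilityTheory.tendsto_cdf_atBot ν).eventually_le_const h0).exists)
    (((ProbabilityTheory.tendsto_cdf_atTop ν).eventually_const_le h1).exists)

theorem measure_cdf_lt {b : ℝ} (h0 : 0 ≤ b) (h1 : b ≤ 1) :
    ν {x | ProbabilityTheory.cdf ν x < b} = ENNReal.ofReal b := by
  refine le_antisymm ?_ ?_
  · rcases h1.eq_or_lt with rfl | h1
    · simpa using prob_le_one
    rcases h0.eq_or_lt with rfl | h0
    · have : {x | ProbabilityTheory.cdf ν x < 0} = ∅ := by
        ext x
        simpa using ProbabilityTheory.cdf_nonneg ν x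
      simp [this]
    obtain ⟨x, hx⟩ := exists_cdf_eq ν h0 h1
    calc ν {x | ProbabilityTheory.cdf ν x < b} ≤ ν (Set.Iic x) :=
          measure_mono fun y hy => le_of_lt ((ProbabilityTheory.monotone_cdf ν).reflect_lt
            (lt_of_lt_of_eq hy hx.symm))
      _ = ENNReal.ofReal b := by rw [← hx, ProbabilityTheory.ofReal_cdf]
  · refine le_of_forall_lt fun a ha => ?_
    obtain ⟨r, hr, har, hrb⟩ := ENNReal.lt_iff_exists_real_btwn.1 ha
    have hrb' : r < b := (ENNReal.ofReal_lt_ofReal_iff_of_nonneg hr).1 hrb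
    rcases hr.eq_or_lt with rfl | hr
    · simp at har
    obtain ⟨x, hx⟩ := exists_cdf_eq ν hr (hrb'.trans_le h1)
    calc a < ENNReal.ofReal r := har
      _ = ν (Set.Iic x) := by rw [← hx, ProbabilityTheory.ofReal_cdf]
      _ ≤ _ := measure_mono fun y hy =>
          (((ProbabilityTheory.monotone_cdf ν) hy).trans_eq hx).trans_lt hrb'

theorem measure_quantileLevel_eq {j m : ℕ} (hm : m < 2 ^ j) :
    ν {x | quantileLevel ν j x = m} = (2 ^ j)⁻¹ := by
  have h2 : (0 : ℝ) < 2 ^ j := by positivity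
  have hm' : ((m : ℝ) + 1) ≤ 2 ^ j := by exact_mod_cast hm
  have hle : (m : ℝ) / 2 ^ j ≤ (m + 1) / 2 ^ j := by gcongr; linarith
  have hsub : {x | ProbabilityTheory.cdf ν x < m / 2 ^ j} ⊆
      {x | ProbabilityTheory.cdf ν x < (m + 1) / 2 ^ j} :=
    fun x (hx : _ < _) => lt_of_lt_of_le hx hle
  rw [quantileLevel_preimage_eq, measure_sdiff hsub (measurableSet_cdf_lt ν _).nullMeasurableSet (measure_ne_top _ _),
    measure_cdf_lt ν (by positivity) ((div_le_one h2).2 hm'),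
    measure_cdf_lt ν (by positivity) (hle.trans ((div_le_one h2).2 hm')),
    ← ENNReal.ofReal_sub _ (by positivity), ← sub_div, add_sub_cancel_left, one_div,
    ENNReal.ofReal_inv_of_pos h2, ENNReal.ofReal_pow (by norm_num)]
  simp

theorem measure_one_le_cdf : ν {x | 1 ≤ ProbabilityTheory.cdf ν x} = 0 := by
  have h := measure_cdf_lt ν zero_le_one le_rfl
  rw [ENNReal.ofReal_one, ← prob_compl_eq_zero_iff (measurableSet_cdf_lt ν 1)] at h
  convert h using 2
  ext x
  simp

theorem measure_quantileLevel_le (j m : ℕ) : ν {x | quantileLevel ν j x = m} ≤ (2 ^ j)⁻¹ := by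
  rcases lt_or_ge m (2 ^ j) with hm | hm
  · exact (measure_quantileLevel_eq ν hm).le
  · refine le_of_eq_of_le (measure_mono_null (fun x hx => ?_) (measure_one_le_cdf ν)) zero_le
    by_contra h
    have := quantileLevel_lt_of_cdf_lt ν (j := j) (not_le.1 h)
    rw [show quantileLevel ν j x = m from hx] at this
    omega

instance (K : ℕ) (c : Fin K → Bool) : IsProbabilityMeasure (cellMeasure ν K c) := by
  constructor
  rw [cellMeasure, Measure.smul_apply, Measure.restrict_apply_univ,
    measure_quantileLevel_eq ν (Nat.ofBits_lt_two_pow c), smul_eq_mul]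
  exact ENNReal.mul_inv_cancel (by positivity) (by finiteness)

theorem ofBits_injective (K : ℕ) : Function.Injective (Nat.ofBits : (Fin K → Bool) → ℕ) := by
  intro c c' h
  funext i
  rw [← Nat.testBit_ofBits_lt c i i.2, ← Nat.testBit_ofBits_lt c' i i.2, h]

theorem eq_smul_sum_cellMeasure (K : ℕ) :
    ν = (2 ^ K : ENNReal)⁻¹ • ∑ c, cellMeasure ν K c := by
  have hU : ⋃ c : Fin K → Bool, {x | quantileLevel ν K x = Nat.ofBits c} =ᵐ[ν] Set.univ := by
    rw [Filter.eventuallyEq_univ, mem_ae_iff]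
    refine measure_mono_null (fun x hx => ?_) (measure_one_le_cdf ν)
    by_contra h
    refine hx (Set.mem_iUnion.2 ⟨fun i => (quantileLevel ν K x).testBit i, ?_⟩)
    exact ((Nat.ofBits_testBit _ _).trans
      (Nat.mod_eq_of_lt (quantileLevel_lt_of_cdf_lt ν (not_le.1 h)))).symm
  have hd : Pairwise (Function.onFun Disjoint
      fun c : Fin K → Bool => {x | quantileLevel ν K x = Nat.ofBits c}) := by
    intro c c' hc
    refine Set.disjoint_left.2 fun x hx hx' => hc (ofBits_injective K ?_)
    exact (Eq.symm hx).trans hx'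
  have h := Measure.restrict_iUnion (μ := ν) hd
    fun c => measurableSet_quantileLevel_eq ν K (Nat.ofBits c)
  rw [Measure.restrict_congr_set hU, Measure.restrict_univ, Measure.sum_fintype] at h
  simp only [cellMeasure, ← Finset.smul_sum]
  rw [← h, smul_smul, ENNReal.inv_mul_cancel (by positivity) (by finiteness), one_smul]

theorem map_fst_cellCoupling (K : ℕ) (σ : (Fin K → Bool) → (Fin K → Bool)) :
    (cellCoupling ν K σ).map Prod.fst = ν := by
  conv_rhs => rw [eq_smul_sum_cellMeasure ν K]
  rw [cellCoupling, Measure.map_smul, Measure.map_finset_sum measurable_fst.aemeasurable]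
  simp

theorem map_snd_cellCoupling {K : ℕ} {σ : (Fin K → Bool) → (Fin K → Bool)}
    (hσ : Function.Bijective σ) : (cellCoupling ν K σ).map Prod.snd = ν := by
  conv_rhs => rw [eq_smul_sum_cellMeasure ν K]
  rw [cellCoupling, Measure.map_smul, Measure.map_finset_sum measurable_snd.aemeasurable]
  simp [hσ.sum_comp fun c => cellMeasure ν K c]

end DyadicCells

theorem ofBits_update_not_div {K : ℕ} (c : Fin K → Bool) (k : Fin K) :
    Nat.ofBits (Function.update c k (!c k)) / 2 ^ (k.1 + 1) = Nat.ofBits c / 2 ^ (k.1 + 1) := by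
  refine Nat.eq_of_testBit_eq fun i => ?_
  rw [Nat.testBit_div_two_pow, Nat.testBit_div_two_pow]
  rcases lt_or_ge (i + (k.1 + 1)) K with h | h
  · rw [Nat.testBit_ofBits_lt _ _ h, Nat.testBit_ofBits_lt _ _ h, Function.update_of_ne]
    intro h'
    have := congrArg Fin.val h'
    simp at this
    omega
  · rw [Nat.testBit_ofBits_ge _ _ h, Nat.testBit_ofBits_ge _ _ h]

theorem update_not_bijective {K : ℕ} (k : Fin K) :
    Function.Bijective fun c : Fin K → Bool => Function.update c k (!c k) :=
  Function.Involutive.bijective fun c => by simp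

theorem expAlphaMeasure_Ici_le {α c z : ℝ} (hα : 1 < α) (hc : 0 < c) (hz : 0 < z) :
    expAlphaMeasure α c (Set.Ici z) ≤
      ENNReal.ofReal (c * Real.exp (-|z| ^ α) / (α * z ^ (α - 1))) := by
  have hα0 : 0 < α := by linarith
  have hzα : 0 < z ^ (α - 1) := Real.rpow_pos_of_pos hz _
  set g : ℝ → ℝ := fun x => -(c * Real.exp (-x ^ α) / (α * z ^ (α - 1))) with hg
  set g' : ℝ → ℝ := fun x => c * Real.exp (-x ^ α) * (x ^ (α - 1) / z ^ (α - 1)) with hg'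
  have hd : ∀ x ∈ Set.Ici z, HasDerivAt g (g' x) x := by
    intro x hx
    have hx0 : x ≠ 0 := (hz.trans_le hx).ne'
    have h := ((((Real.hasDerivAt_rpow_const (p := α) (Or.inl hx0)).neg.exp).const_mul c).div_const
      (α * z ^ (α - 1))).neg
    refine h.congr_deriv ?_
    simp only [hg']
    field_simp
    exact mul_comm _ _
  have hpos : ∀ x ∈ Set.Ioi z, 0 ≤ g' x := fun x hx => by
    have hx0 : 0 < x := hz.trans hx
    positivity
  have hlim : Filter.Tendsto g Filter.atTop (nhds 0) := by
    have h1 : Filter.Tendsto (fun x : ℝ => Real.exp (-x ^ α)) Filter.atTop (nhds 0) :=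
      Real.tendsto_exp_neg_atTop_nhds_zero.comp (tendsto_rpow_atTop hα0)
    simpa [hg] using ((h1.const_mul c).div_const (α * z ^ (α - 1))).neg
  have hint := integrableOn_Ioi_deriv_of_nonneg' hd hpos hlim
  have hval := integral_Ioi_of_hasDerivAt_of_nonneg' hd hpos hlim
  rw [expAlphaMeasure, withDensity_apply _ measurableSet_Ici, setLIntegral_congr Ioi_ae_eq_Ici.symm]
  calc ∫⁻ x in Set.Ioi z, ENNReal.ofReal (c * Real.exp (-|x| ^ α))
      ≤ ∫⁻ x in Set.Ioi z, ENNReal.ofReal (g' x) := by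
        refine setLIntegral_mono' measurableSet_Ioi fun x hx => ENNReal.ofReal_le_ofReal ?_
        have hx0 : 0 < x := hz.trans hx
        rw [abs_of_pos hx0]
        refine le_mul_of_one_le_right (by positivity) ((one_le_div hzα).2 ?_)
        exact Real.rpow_le_rpow hz.le (le_of_lt hx) (by linarith)
    _ = ENNReal.ofReal (∫ x in Set.Ioi z, g' x) :=
        (ofReal_integral_eq_lintegral_ofReal hint
          (ae_restrict_of_forall_mem measurableSet_Ioi hpos)).symm
    _ = _ := by rw [hval, abs_of_pos hz]; simp [hg]

theorem expAlphaMeasure_Iic_eq (α c z : ℝ) :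
    expAlphaMeasure α c (Set.Iic z) = expAlphaMeasure α c (Set.Ici (-z)) := by
  rw [expAlphaMeasure, withDensity_apply _ measurableSet_Iic, withDensity_apply _ measurableSet_Ici,
    ← (Measure.measurePreserving_neg volume).setLIntegral_comp_preimage_emb
      (MeasurableEquiv.neg ℝ).measurableEmbedding]
  simp

theorem min_tail_le {α c z : ℝ} (hα : 1 < α) (hc : 0 < c) (hz : z ≠ 0) :
    min (expAlphaMeasure α c (Set.Iic z)) (expAlphaMeasure α c (Set.Ici z)) ≤
      ENNReal.ofReal (c * Real.exp (-|z| ^ α) / (α * |z| ^ (α - 1))) := by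
  rcases hz.lt_or_gt with hz | hz
  · refine (min_le_left _ _).trans ?_
    rw [expAlphaMeasure_Iic_eq]
    simpa [abs_of_neg hz] using expAlphaMeasure_Ici_le hα hc (neg_pos.2 hz)
  · refine (min_le_right _ _).trans ?_
    simpa [abs_of_pos hz] using expAlphaMeasure_Ici_le hα hc hz

theorem inv_two_pow_le (j : ℕ) :
    ((2 : ℝ) ^ j)⁻¹ ≤ 11 * ((1 + j : ℝ)⁻¹ * Real.exp (-((1 + j) / 2))) := by
  have hl := Real.log_two_gt_d9
  have h1 : (0 : ℝ) < 1 + j := by positivity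
  have h2 : (2 : ℝ) ^ j = Real.exp (Real.log 2 * (1 + j)) / 2 := by
    rw [← Real.rpow_def_of_pos two_pos, Real.rpow_add two_pos, Real.rpow_one, Real.rpow_natCast]
    ring
  have h3 := Real.add_one_le_exp ((Real.log 2 - 1 / 2) * (1 + j))
  have h4 : 2 * (1 + j) ≤ 11 * Real.exp ((Real.log 2 - 1 / 2) * (1 + j)) := by nlinarith
  have h5 : Real.exp (Real.log 2 * (1 + j)) =
      Real.exp ((Real.log 2 - 1 / 2) * (1 + j)) * Real.exp ((1 + j) / 2) := by
    rw [← Real.exp_add]; ring_nf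
  rw [h2, h5, Real.exp_neg]
  have h6 := Real.exp_pos ((Real.log 2 - 1 / 2) * (1 + j))
  have h7 := Real.exp_pos ((1 + j : ℝ) / 2)
  rw [inv_div, ← mul_inv, ← div_eq_mul_inv, div_le_div_iff₀ (by positivity) (by positivity)]
  nlinarith

theorem min_cell_tail_le {α c : ℝ} (hα : 1 < α) (hα2 : α < 2) (hc : 0 < c) (z : ℝ) (j : ℕ) :
    min ((2 ^ j)⁻¹) (min (expAlphaMeasure α c (Set.Iic z)) (expAlphaMeasure α c (Set.Ici z))) ≤
      ENNReal.ofReal ((2 + 11 / c) * ((1 + j : ℝ) ^ (1 - 1 / α))⁻¹) *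
        ENNReal.ofReal (c * Real.exp (-|z| ^ α)) := by
  have hj : (1 : ℝ) ≤ 1 + j := by simp
  have hj0 : (0 : ℝ) < 1 + j := by positivity
  have hγ0 : 0 ≤ 1 - 1 / α := by
    rw [sub_nonneg, div_le_one (by linarith)]; exact hα.le
  have hγ1 : 1 - 1 / α ≤ 1 := by
    have : 0 < 1 / α := by positivity
    linarith
  have hP : 0 < (1 + j : ℝ) ^ (1 - 1 / α) := by positivity
  rw [← ENNReal.ofReal_mul (by positivity)]
  rcases le_or_gt ((1 + j : ℝ) / 2) (|z| ^ α) with h | h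
  · have hz : z ≠ 0 := by
      rintro rfl
      rw [abs_zero, Real.zero_rpow (by linarith)] at h
      linarith
    have hz' : 0 < |z| := abs_pos.2 hz
    refine (min_le_right _ _).trans ((min_tail_le hα hc hz).trans (ENNReal.ofReal_le_ofReal ?_))
    have hpow : (1 + j : ℝ) ^ (1 - 1 / α) ≤ 2 * |z| ^ (α - 1) := by
      have h1 : |z| ^ (α - 1) = (|z| ^ α) ^ (1 - 1 / α) := by
        rw [← Real.rpow_mul hz'.le]
        congr 1
        field_simp
      have h2 := Real.rpow_le_rpow (by positivity) h hγ0
      rw [Real.div_rpow hj0.le zero_le_two, ← h1] at h2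
      have h3 : (2 : ℝ) ^ (1 - 1 / α) ≤ 2 := by
        simpa using Real.rpow_le_rpow_of_exponent_le one_le_two hγ1
      rw [div_le_iff₀ (by positivity)] at h2
      have h4 : 0 < |z| ^ (α - 1) := by positivity
      nlinarith
    have h5 : (α * |z| ^ (α - 1))⁻¹ ≤ (2 + 11 / c) * ((1 + j : ℝ) ^ (1 - 1 / α))⁻¹ := by
      have h4 : 0 < |z| ^ (α - 1) := by positivity
      calc (α * |z| ^ (α - 1))⁻¹ ≤ (|z| ^ (α - 1))⁻¹ :=
            inv_anti₀ h4 (le_mul_of_one_le_left h4.le hα.le)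
        _ ≤ 2 * ((1 + j : ℝ) ^ (1 - 1 / α))⁻¹ := by
            rw [← div_eq_mul_inv, le_div_iff₀ hP, inv_mul_le_iff₀ h4]
            linarith
        _ ≤ _ := by
            gcongr
            have : 0 < 11 / c := by positivity
            linarith
    rw [div_eq_mul_inv, mul_comm]
    exact mul_le_mul_of_nonneg_right h5 (by positivity)
  · refine (min_le_left _ _).trans ?_
    have h0 : ((2 : ENNReal) ^ j)⁻¹ = ENNReal.ofReal (((2 : ℝ) ^ j)⁻¹) := by
      rw [ENNReal.ofReal_inv_of_pos (by positivity), ENNReal.ofReal_pow zero_le_two]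
      simp
    rw [h0]
    refine ENNReal.ofReal_le_ofReal ((inv_two_pow_le j).trans ?_)
    have h1 : (1 + j : ℝ)⁻¹ ≤ ((1 + j : ℝ) ^ (1 - 1 / α))⁻¹ :=
      inv_anti₀ hP (by simpa using Real.rpow_le_rpow_of_exponent_le hj hγ1)
    calc 11 * ((1 + j : ℝ)⁻¹ * Real.exp (-((1 + j) / 2)))
        ≤ 11 * (((1 + j : ℝ) ^ (1 - 1 / α))⁻¹ * Real.exp (-|z| ^ α)) := by gcongr
      _ = 11 / c * ((1 + j : ℝ) ^ (1 - 1 / α))⁻¹ * (c * Real.exp (-|z| ^ α)) := by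
          field_simp
      _ ≤ _ := by gcongr; linarith

theorem isProbabilityMeasure_expAlphaMeasure {α c : ℝ} (hc : 0 < c)
    (h : ∫ x : ℝ, c * Real.exp (-|x| ^ α) = 1) : IsProbabilityMeasure (expAlphaMeasure α c) := by
  constructor
  rw [expAlphaMeasure, withDensity_apply _ MeasurableSet.univ, Measure.restrict_univ,
    ← ofReal_integral_eq_lintegral_ofReal, h, ENNReal.ofReal_one]
  · by_contra hn
    rw [integral_undef hn] at h
    exact zero_ne_one h
  · exact Filter.Eventually.of_forall fun x => by positivity

theorem lintegral_cell_sub_le {α c : ℝ} (hα : 1 < α) (hα2 : α < 2) (hc : 0 < c)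
    [IsProbabilityMeasure (expAlphaMeasure α c)] [NullSingletonClass (expAlphaMeasure α c)]
    {j K : ℕ} (hj : j ≤ K) {σ : (Fin K → Bool) → (Fin K → Bool)} (hσb : Function.Bijective σ)
    (hσ : ∀ c, Nat.ofBits (σ c) / 2 ^ (K - j) = Nat.ofBits c / 2 ^ (K - j))
    {h h' : ℝ → ℝ} (hd : ∀ x, HasDerivAt h (h' x) x) (hc' : Continuous h') :
    (2 ^ K : ENNReal)⁻¹ * ∑ b, ∫⁻ s, ∫⁻ t, ‖h s - h t‖ₑ
        ∂cellMeasure (expAlphaMeasure α c) K (σ b) ∂cellMeasure (expAlphaMeasure α c) K b ≤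
      2 * ENNReal.ofReal ((2 + 11 / c) * ((1 + j : ℝ) ^ (1 - 1 / α))⁻¹) *
        ∫⁻ z, ‖h' z‖ₑ ∂expAlphaMeasure α c := by
  set ν := expAlphaMeasure α c with hν
  have hm : Measurable h := (continuous_iff_continuousAt.2 fun x => (hd x).continuousAt).measurable
  have hm2 : Measurable fun p : ℝ × ℝ => ‖h p.1 - h p.2‖ₑ :=
    ((hm.comp measurable_fst).sub (hm.comp measurable_snd)).enorm
  have : IsProbabilityMeasure (cellCoupling ν K σ) := by
    constructor
    rw [← Set.preimage_univ (f := Prod.fst), ← Measure.map_apply measurable_fst .univ,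
      map_fst_cellCoupling, measure_univ]
  have key := lintegral_coupling_le (ρ := fun x => ENNReal.ofReal (c * Real.exp (-|x| ^ α)))
    (by fun_prop) rfl (map_fst_cellCoupling ν K σ) (map_snd_cellCoupling ν hσb)
    (quantileLevel_monotone ν j) (ae_quantileLevel_cellCoupling ν hj hσ)
    (fun z => (min_le_min_right _ (measure_quantileLevel_le ν j _)).trans
      (min_cell_tail_le hα hα2 hc z j)) hd hc'
  refine le_of_eq_of_le ?_ key
  rw [cellCoupling, lintegral_smul_measure, lintegral_finsetSum_measure, smul_eq_mul]
  congr 1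
  exact Finset.sum_congr rfl fun b _ => (lintegral_prod _ hm2.aemeasurable).symm

theorem average_lintegral_update_sub_le {α c : ℝ} (hα : 1 < α) (hα2 : α < 2) (hc : 0 < c)
    [IsProbabilityMeasure (expAlphaMeasure α c)] [NullSingletonClass (expAlphaMeasure α c)]
    {N : ℕ} (K : Fin N → ℕ) {f : (Fin N → ℝ) → ℝ} (hf : ContDiff ℝ (⊤ : ℕ∞) f) (i : Fin N)
    {j : ℕ} (hj : j ≤ K i) {σ : (Fin (K i) → Bool) → (Fin (K i) → Bool)}
    (hσb : Function.Bijective σ)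
    (hσ : ∀ c, Nat.ofBits (σ c) / 2 ^ (K i - j) = Nat.ofBits c / 2 ^ (K i - j)) :
    (∏ i, (2 ^ K i : ENNReal)⁻¹) * ∑ b : ∀ i, Fin (K i) → Bool, ∫⁻ z, ∫⁻ s, ∫⁻ t,
        ‖f (Function.update z i s) - f (Function.update z i t)‖ₑ
        ∂cellMeasure (expAlphaMeasure α c) (K i) (σ (b i))
        ∂cellMeasure (expAlphaMeasure α c) (K i) (b i)
        ∂Measure.pi (fun k => cellMeasure (expAlphaMeasure α c) (K k) (b k)) ≤
      ENNReal.ofReal (2 * ((2 + 11 / c) * ((1 + j : ℝ) ^ (1 - 1 / α))⁻¹)) *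
        ∫⁻ z, ‖pderiv N i f z‖ₑ ∂expAlphaPi α c N := by
  set ν := expAlphaMeasure α c with hν
  have hfm : Measurable f := hf.continuous.measurable
  have hpc : Continuous (pderiv N i f) :=
    (hf.continuous_fderiv (by simp)).clm_apply continuous_const
  have hd : ∀ (z : Fin N → ℝ) (t : ℝ), HasDerivAt (fun t => f (Function.update z i t))
      (pderiv N i f (Function.update z i t)) t := fun z t =>
    ((hf.differentiable (by simp)) _).hasFDerivAt.comp_hasDerivAt t (hasDerivAt_update z i t)
  rw [ENNReal.ofReal_mul zero_le_two, ENNReal.ofReal_ofNat, lintegral_pi_mixture_of_update_eq (fun i => (2 ^ K i : ENNReal)⁻¹)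
    (fun i => cellMeasure ν (K i)) (fun _ => ν) (fun i => eq_smul_sum_cellMeasure ν (K i)) i
    (by simp [ENNReal.inv_mul_cancel])
    (fun b z => ∫⁻ s, ∫⁻ t, ‖f (Function.update z i s) - f (Function.update z i t)‖ₑ
      ∂cellMeasure ν (K i) (σ b) ∂cellMeasure ν (K i) b)
    (fun b => measurable_lintegral_update_sub hfm i _ _) (fun b z t => by simp),
    expAlphaPi, ← lintegral_pi_update_self (fun _ => ν) i hpc.measurable.enorm,
    ← lintegral_const_mul']
  · refine lintegral_mono fun z => lintegral_cell_sub_le hα hα2 hc hj hσb hσ (hd z) ?_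
    exact hpc.comp (continuous_const.update i continuous_id)
  · finiteness

theorem abs_bitDeriv {ι : Type*} [DecidableEq ι] (k : ι) (h : (ι → Bool) → ℝ) (x : ι → Bool) :
    |bitDeriv k h x| = |h x - h (Function.update x k (!x k))| / 2 := by
  rw [bitDeriv, abs_div, abs_two]
  congr 1
  cases hx : x k
  · have : Function.update x k false = x := by rw [← hx, Function.update_eq_self]
    rw [this, abs_sub_comm, Bool.not_false]
  · have : Function.update x k true = x := by rw [← hx, Function.update_eq_self]
    rw [this, Bool.not_true]

theorem ofReal_average_le {β : Type*} [Fintype β] {N : ℕ} (K : Fin N → ℕ) {a : β → ℝ}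
    {T : β → ENNReal} (h : ∀ b, ENNReal.ofReal (a b) ≤ T b) :
    ENNReal.ofReal ((∏ i, ((2 : ℝ) ^ K i)⁻¹) * ∑ b, a b) ≤
      (∏ i, (2 ^ K i : ENNReal)⁻¹) * ∑ b, T b := by
  have hw : ENNReal.ofReal (∏ i, ((2 : ℝ) ^ K i)⁻¹) = ∏ i, (2 ^ K i : ENNReal)⁻¹ := by
    rw [ENNReal.ofReal_prod_of_nonneg fun i _ => by positivity]
    refine Finset.prod_congr rfl fun i _ => ?_
    rw [ENNReal.ofReal_inv_of_pos (by positivity), ENNReal.ofReal_pow zero_le_two,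
      ENNReal.ofReal_ofNat]
  rw [ENNReal.ofReal_mul (Finset.prod_nonneg fun i _ => by positivity), hw]
  gcongr
  exact (Finset.le_sum_of_subadditive ENNReal.ofReal ENNReal.ofReal_zero.le
    (fun _ _ => ENNReal.ofReal_add_le) _ _).trans (Finset.sum_le_sum fun b _ => h b)

theorem cubeAvg_sigma {N : ℕ} (K : Fin N → ℕ) (φ : (∀ i, Fin (K i) → Bool) → ℝ) :
    cubeAvg (fun x : (Σ i, Fin (K i)) → Bool => φ (Sigma.curry x)) =
      (∏ i, ((2 : ℝ) ^ K i)⁻¹) * ∑ b, φ b := by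
  have hs : ∑ x : (Σ i, Fin (K i)) → Bool, φ (Sigma.curry x) = ∑ b, φ b :=
    (Equiv.piCurry fun (i : Fin N) (_ : Fin (K i)) => Bool).sum_comp φ
  rw [cubeAvg, hs, Fintype.card_sigma, ← Finset.prod_pow_eq_pow_sum]
  simp

section Assembly

variable {α c : ℝ} {N : ℕ} (K : Fin N → ℕ) {f : (Fin N → ℝ) → ℝ}

/-- The mean of `f` over the product of the quantile cells with digits `b`. -/
noncomputable def cellMean (α c : ℝ) (K : Fin N → ℕ) (f : (Fin N → ℝ) → ℝ)
    (b : ∀ i, Fin (K i) → Bool) : ℝ :=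
  ∫ x, f x ∂Measure.pi fun i => cellMeasure (expAlphaMeasure α c) (K i) (b i)

theorem ofReal_l1norm {i : Fin N} (hi : Integrable (pderiv N i f) (expAlphaPi α c N)) :
    ∫⁻ z, ‖pderiv N i f z‖ₑ ∂expAlphaPi α c N =
      ENNReal.ofReal (l1norm (expAlphaPi α c N) (pderiv N i f)) :=
  (ofReal_integral_norm_eq_lintegral_enorm hi).symm

theorem l1norm_nonneg {X : Type*} [MeasurableSpace X] (μ : Measure X) (g : X → ℝ) :
    0 ≤ l1norm μ g :=
  integral_nonneg fun _ => abs_nonneg _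

theorem abs_integral_le_one {Y : Type*} [MeasurableSpace Y] (κ : Measure Y)
    [IsProbabilityMeasure κ] {f : Y → ℝ} (hb : ∀ x, |f x| ≤ 1) : |∫ x, f x ∂κ| ≤ 1 := by
  simpa using norm_integral_le_of_norm_le_const (μ := κ) (f := f) (Filter.Eventually.of_forall hb)

variable [IsProbabilityMeasure (expAlphaMeasure α c)]
  [NullSingletonClass (expAlphaMeasure α c)]

theorem abs_cellMean_le (hb : ∀ x, |f x| ≤ 1) (b : ∀ i, Fin (K i) → Bool) :
    |cellMean α c K f b| ≤ 1 :=
  abs_integral_le_one _ hb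

theorem integral_expAlphaPi_eq (hf : Measurable f) (hb : ∀ x, |f x| ≤ 1) :
    ∫ x, f x ∂expAlphaPi α c N = cubeAvg (fun x => cellMean α c K f (Sigma.curry x)) := by
  rw [cubeAvg_sigma K (cellMean α c K f), expAlphaPi,
    pi_mixture (fun i => (2 ^ K i : ENNReal)⁻¹) (fun i => cellMeasure (expAlphaMeasure α c) (K i))
      _ (fun i => eq_smul_sum_cellMeasure _ (K i)), integral_smul_measure,
    integral_finsetSum_measure fun b _ => integrable_of_abs_le_one hf hb, smul_eq_mul,
    ENNReal.toReal_prod]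
  simp [cellMean]

theorem cubeAvg_abs_bitDeriv_cellMean_le (hα : 1 < α) (hα2 : α < 2) (hc : 0 < c)
    (hf : ContDiff ℝ (⊤ : ℕ∞) f) (hb : ∀ x, |f x| ≤ 1) (i : Fin N) (k : Fin (K i))
    (hi : Integrable (pderiv N i f) (expAlphaPi α c N)) :
    cubeAvg (fun x => |bitDeriv ⟨i, k⟩ (fun x => cellMean α c K f (Sigma.curry x)) x|) ≤
      2 * ((2 + 11 / c) * ((1 + (K i - (k.1 + 1) : ℕ) : ℝ) ^ (1 - 1 / α))⁻¹) *
        l1norm (expAlphaPi α c N) (pderiv N i f) := by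
  have hK : K i - (K i - (k.1 + 1)) = k.1 + 1 := by omega
  have h := average_lintegral_update_sub_le hα hα2 hc K hf i (j := K i - (k.1 + 1))
    (Nat.sub_le _ _) (update_not_bijective k) (fun b => by rw [hK]; exact ofBits_update_not_div b k)
  have hl : 0 ≤ l1norm (expAlphaPi α c N) (pderiv N i f) := l1norm_nonneg _ _
  rw [ofReal_l1norm hi, ← ENNReal.ofReal_mul (by positivity)] at h
  refine (cubeAvg_mono (g := fun x => (fun b : ∀ i, Fin (K i) → Bool => |cellMean α c K f b -
    cellMean α c K f (Function.update b i (Function.update (b i) k (!b i k)))|)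
      (Sigma.curry x)) fun x => ?_).trans ?_
  · rw [abs_bitDeriv, Sigma.curry_update]
    exact half_le_self (abs_nonneg _)
  · rw [cubeAvg_sigma K fun b => |cellMean α c K f b -
      cellMean α c K f (Function.update b i (Function.update (b i) k (!b i k)))|]
    refine (ENNReal.ofReal_le_ofReal_iff (by positivity)).1 ((ofReal_average_le K ?_).trans h)
    intro b
    refine le_of_eq_of_le ?_ (enorm_integral_sub_pi_update_le
      (fun k => cellMeasure (expAlphaMeasure α c) (K k) (b k)) hf.continuous.measurable hb i
      (cellMeasure (expAlphaMeasure α c) (K i) (Function.update (b i) k (!b i k))))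
    rw [← ofReal_norm, Real.norm_eq_abs, cellMean, cellMean]
    congr 5
    funext l
    by_cases hl : l = i
    · subst hl; simp
    · simp [hl]

theorem average_cell_variance_le (hα : 1 < α) (hα2 : α < 2) (hc : 0 < c)
    (hf : ContDiff ℝ (⊤ : ℕ∞) f) (hb : ∀ x, |f x| ≤ 1)
    (hi : ∀ i, Integrable (pderiv N i f) (expAlphaPi α c N)) :
    (∏ i, ((2 : ℝ) ^ K i)⁻¹) * ∑ b, (cellMean α c K (fun x => f x ^ 2) b -
        cellMean α c K f b ^ 2) ≤
      ∑ i, 2 * ((2 + 11 / c) * ((1 + K i : ℝ) ^ (1 - 1 / α))⁻¹) *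
        l1norm (expAlphaPi α c N) (pderiv N i f) := by
  have hl : ∀ i, 0 ≤ l1norm (expAlphaPi α c N) (pderiv N i f) := fun i => l1norm_nonneg _ _
  have hnn : ∀ i, 0 ≤ 2 * ((2 + 11 / c) * ((1 + K i : ℝ) ^ (1 - 1 / α))⁻¹) *
      l1norm (expAlphaPi α c N) (pderiv N i f) := fun i => by have := hl i; positivity
  refine (ENNReal.ofReal_le_ofReal_iff (Finset.sum_nonneg fun i _ => hnn i)).1 ?_
  have key : ∀ b : ∀ i, Fin (K i) → Bool,
      ENNReal.ofReal (cellMean α c K (fun x => f x ^ 2) b - cellMean α c K f b ^ 2) ≤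
        ∑ i, ∫⁻ z, ∫⁻ s, ∫⁻ t, ‖f (Function.update z i s) - f (Function.update z i t)‖ₑ
          ∂cellMeasure (expAlphaMeasure α c) (K i) (b i)
          ∂cellMeasure (expAlphaMeasure α c) (K i) (b i)
          ∂Measure.pi (fun k => cellMeasure (expAlphaMeasure α c) (K k) (b k)) := fun b =>
    (ofReal_variance_le_lintegral_sub _ hf.continuous.measurable hb).trans
      (lintegral_sub_le_sum (fun k => cellMeasure (expAlphaMeasure α c) (K k) (b k))
        hf.continuous.measurable)
  refine (ofReal_average_le K key).trans ?_
  rw [Finset.sum_comm, Finset.mul_sum, ENNReal.ofReal_sum_of_nonneg fun i _ => hnn i]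
  refine Finset.sum_le_sum fun i _ => ?_
  have h := average_lintegral_update_sub_le hα hα2 hc K hf i le_rfl
    (σ := fun b => b) Function.bijective_id (fun _ => rfl)
  rw [ofReal_l1norm (hi i), ← ENNReal.ofReal_mul (by positivity)] at h
  exact h

theorem var'_le_add (hα : 1 < α) (hα2 : α < 2) (hc : 0 < c)
    (hf : ContDiff ℝ (⊤ : ℕ∞) f) (hb : ∀ x, |f x| ≤ 1)
    (hi : ∀ i, Integrable (pderiv N i f) (expAlphaPi α c N)) {M : ℝ} (hM : 1 ≤ M)
    (l : Fin N → ℝ) (hl : ∀ i, 0 < l i)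
    (ha : ∀ i (k : Fin (K i)), cubeAvg (fun x => |bitDeriv ⟨i, k⟩
      (fun x => cellMean α c K f (Sigma.curry x)) x|) ≤ M * Real.exp (-l i)) :
    var' (expAlphaPi α c N) f ≤
      ∑ i, (2 * ((2 + 11 / c) * ((1 + K i : ℝ) ^ (1 - 1 / α))⁻¹) *
          l1norm (expAlphaPi α c N) (pderiv N i f) +
        ∑ k : Fin (K i), 2 * M * cubeAvg (fun x => |bitDeriv ⟨i, k⟩
          (fun x => cellMean α c K f (Sigma.curry x)) x|) / l i) := by
  have h1 := average_cell_variance_le K hα hα2 hc hf hb hi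
  have h2 := cube_talagrand hM (fun p : Σ i, Fin (K i) => l p.1) (fun p => hl p.1)
    (fun x => cellMean α c K f (Sigma.curry x)) (fun x => abs_cellMean_le K hb _)
    (fun p => ha p.1 p.2)
  have hsq : ∀ x, |f x ^ 2| ≤ 1 := fun x => by
    rw [abs_pow]; exact pow_le_one₀ (abs_nonneg _) (hb x)
  rw [Fintype.sum_sigma, cubeAvg_sigma K fun b => cellMean α c K f b ^ 2] at h2
  rw [Finset.sum_sub_distrib, mul_sub, ← cubeAvg_sigma K (cellMean α c K fun x => f x ^ 2),
    ← integral_expAlphaPi_eq K (hf.continuous.measurable.pow_const 2) hsq] at h1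
  rw [← integral_expAlphaPi_eq K hf.continuous.measurable hb] at h2
  rw [var', Finset.sum_add_distrib]
  linarith

end Assembly

theorem sum_inv_rpow_le {γ : ℝ} (h0 : 0 ≤ γ) (h1 : γ ≤ 1 / 2) (K : ℕ) :
    ∑ j ∈ Finset.range K, ((1 + j : ℝ) ^ γ)⁻¹ ≤ 2 * (K : ℝ) ^ (1 - γ) := by
  induction K with
  | zero => simp; positivity
  | succ K ih =>
    rw [Finset.sum_range_succ]
    refine (add_le_add_left ih _).trans ?_
    have hK1 : (0 : ℝ) < 1 + K := by positivity
    have hP : 0 < (1 + K : ℝ) ^ γ := by positivity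
    have hR : ((K + 1 : ℕ) : ℝ) ^ (1 - γ) = (1 + K) / (1 + K : ℝ) ^ γ := by
      rw [Real.rpow_sub (by positivity), Real.rpow_one]
      push_cast
      rw [add_comm (1 : ℝ)]
    have hB : (K : ℝ) ^ (1 - γ) * (1 + K : ℝ) ^ γ ≤ K + 1 / 2 := by
      rcases K.eq_zero_or_pos with rfl | hK
      · simp [Real.zero_rpow (by linarith : 1 - γ ≠ 0)]
      have hK : (0 : ℝ) < K := by exact_mod_cast hK
      have hb := rpow_one_add_le_one_add_mul_self (s := (K : ℝ)⁻¹)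
        (by linarith [inv_pos.2 hK]) h0 (by linarith)
      have he : (K : ℝ) ^ (1 - γ) * (1 + K : ℝ) ^ γ = K * (1 + (K : ℝ)⁻¹) ^ γ := by
        have : 1 + (K : ℝ)⁻¹ = (1 + K) / K := by field_simp; ring
        rw [this, Real.div_rpow hK1.le hK.le, Real.rpow_sub hK, Real.rpow_one]
        ring
      rw [he]
      calc (K : ℝ) * (1 + (K : ℝ)⁻¹) ^ γ ≤ K * (1 + γ * (K : ℝ)⁻¹) := by gcongr
        _ = K + γ := by field_simp
        _ ≤ _ := by linarith
    rw [hR, ← mul_div_assoc, le_div_iff₀ hP, add_mul, inv_mul_cancel₀ hP.ne']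
    linarith

theorem sum_fin_inv_rpow_le {γ : ℝ} (h0 : 0 ≤ γ) (h1 : γ ≤ 1 / 2) (K : ℕ) :
    ∑ k : Fin K, ((1 + (K - (k.1 + 1) : ℕ) : ℝ) ^ γ)⁻¹ ≤ 2 * (K : ℝ) ^ (1 - γ) := by
  refine le_of_eq_of_le ?_ (sum_inv_rpow_le h0 h1 K)
  rw [Fin.sum_univ_eq_sum_range (fun k => ((1 + (K - (k + 1) : ℕ) : ℝ) ^ γ)⁻¹),
    ← Finset.sum_range_reflect]
  refine Finset.sum_congr rfl fun k hk => ?_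
  have := Finset.mem_range.1 hk
  rw [show K - (K - 1 - k + 1) = k by omega]

theorem coordinate_sum_le {γ D M I L : ℝ} (h0 : 0 ≤ γ) (h1 : γ ≤ 1 / 2) (hD : 0 ≤ D)
    (hM : 0 ≤ M) (hI : 0 ≤ I) (hL : 0 ≤ L) {K : ℕ} (hK : K = ⌊L⌋₊ + 1) (a : Fin K → ℝ)
    (ha : ∀ k, a k ≤ 2 * (D * ((1 + (K - (k.1 + 1) : ℕ) : ℝ) ^ γ)⁻¹) * I) :
    2 * (D * ((1 + K : ℝ) ^ γ)⁻¹) * I + ∑ k, 2 * M * a k / (1 + L) ≤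
      2 * D * (1 + 4 * M) * (I * (1 + I) / (1 + L) ^ γ) := by
  have hl : 0 < 1 + L := by linarith
  have hlp : 0 < (1 + L) ^ γ := by positivity
  have hK1 : 1 + L ≤ 1 + K := by
    rw [hK]; push_cast; linarith [Nat.lt_floor_add_one L]
  have hK2 : (K : ℝ) ≤ 1 + L := by
    rw [hK]; push_cast; linarith [Nat.floor_le hL]
  have first : 2 * (D * ((1 + K : ℝ) ^ γ)⁻¹) * I ≤ 2 * D * (I / (1 + L) ^ γ) := by
    have : ((1 + K : ℝ) ^ γ)⁻¹ ≤ ((1 + L) ^ γ)⁻¹ :=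
      inv_anti₀ hlp (Real.rpow_le_rpow hl.le hK1 h0)
    calc 2 * (D * ((1 + K : ℝ) ^ γ)⁻¹) * I ≤ 2 * (D * ((1 + L) ^ γ)⁻¹) * I := by gcongr
      _ = _ := by ring
  have second : ∑ k, 2 * M * a k / (1 + L) ≤ 2 * D * (4 * M) * (I / (1 + L) ^ γ) := by
    calc ∑ k, 2 * M * a k / (1 + L)
        ≤ ∑ k : Fin K, 2 * M * (2 * (D * ((1 + (K - (k.1 + 1) : ℕ) : ℝ) ^ γ)⁻¹) * I) /
            (1 + L) := by
          gcongr with k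
          exact ha k
      _ = 4 * M * D * I / (1 + L) *
            ∑ k : Fin K, ((1 + (K - (k.1 + 1) : ℕ) : ℝ) ^ γ)⁻¹ := by
          rw [Finset.mul_sum]
          exact Finset.sum_congr rfl fun k _ => by ring
      _ ≤ 4 * M * D * I / (1 + L) * (2 * (1 + L) ^ (1 - γ)) := by
          gcongr
          refine (sum_fin_inv_rpow_le h0 h1 K).trans ?_
          gcongr
          linarith
      _ = _ := by
          rw [Real.rpow_sub hl, Real.rpow_one]
          field_simp
  have third : I / (1 + L) ^ γ ≤ I * (1 + I) / (1 + L) ^ γ := by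
    gcongr
    exact le_mul_of_one_le_right hI (by linarith)
  calc _ ≤ 2 * D * (1 + 4 * M) * (I / (1 + L) ^ γ) := by linarith
    _ ≤ _ := by gcongr

theorem le_mul_exp_neg_one_add_log {a B I : ℝ} (hI : 0 ≤ I) (ha1 : a ≤ 1) (ha : a ≤ B * I) :
    a ≤ Real.exp 1 * max 1 B * Real.exp (-(1 + max (Real.log (1 / I)) 0)) := by
  have he : Real.exp 1 * max 1 B * Real.exp (-(1 + max (Real.log (1 / I)) 0)) =
      max 1 B * Real.exp (-max (Real.log (1 / I)) 0) := by
    rw [neg_add, Real.exp_add, Real.exp_neg 1]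
    field_simp
  rw [he]
  rcases le_or_gt (Real.log (1 / I)) 0 with h | h
  · rw [max_eq_right h]
    simpa using Or.inl ha1
  · have hI0 : 0 < I := by
      refine hI.lt_of_ne ?_
      rintro rfl
      simp at h
    rw [max_eq_left h.le, one_div, Real.log_inv, neg_neg, Real.exp_log hI0]
    exact ha.trans (mul_le_mul_of_nonneg_right (le_max_right _ _) hI)

theorem cubeAvg_abs_bitDeriv_le_one {ι : Type*} [Fintype ι] [DecidableEq ι] (k : ι)
    {h : (ι → Bool) → ℝ} (hh : ∀ x, |h x| ≤ 1) : cubeAvg (fun x => |bitDeriv k h x|) ≤ 1 := by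
  refine (cubeAvg_mono fun x => ?_).trans_eq (cubeAvg_const 1)
  rw [abs_bitDeriv]
  linarith [abs_sub (h x) (h (Function.update x k (!x k))), hh x,
    hh (Function.update x k (!x k))]

/-- The `L¹` (geometric-influence) form of Talagrand's inequality for products of
the measures `c_α e^{-|x|^α} dx`, `1 < α < 2`, with exponent `β/2 = (1 - 1/α)`. -/
theorem stmt16 (α : ℝ) (hα1 : 1 < α) (hα2 : α < 2) :
    ∃ C : ℝ, 0 < C ∧ ∀ c : ℝ, 0 < c → (∫ x : ℝ, c * Real.exp (-|x| ^ α)) = 1 →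
      ∀ N : ℕ, 1 ≤ N → ∀ f : (Fin N → ℝ) → ℝ, ContDiff ℝ (⊤ : ℕ∞) f → (∀ x, |f x| ≤ 1) →
      (∀ i, Integrable (pderiv N i f) (expAlphaPi α c N)) →
      var' (expAlphaPi α c N) f ≤ C * ∑ i : Fin N,
        l1norm (expAlphaPi α c N) (pderiv N i f) *
          (1 + l1norm (expAlphaPi α c N) (pderiv N i f)) /
          (1 + max (Real.log (1 / l1norm (expAlphaPi α c N) (pderiv N i f))) 0) ^
            ((2 * (1 - 1 / α)) / 2) := by
  set D := 2 + 11 * |∫ x : ℝ, Real.exp (-|x| ^ α)| with hDdef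
  have hD : 0 < D := by positivity
  set M := Real.exp 1 * max 1 (2 * D) with hMdef
  have hM : 1 ≤ M := one_le_mul_of_one_le_of_one_le (Real.one_le_exp zero_le_one) (le_max_left _ _)
  refine ⟨2 * D * (1 + 4 * M), by positivity, fun c hc hint N _ f hf hb hi => ?_⟩
  have := isProbabilityMeasure_expAlphaMeasure hc hint
  have : NullSingletonClass (expAlphaMeasure α c) := nullSingletonClass_withDensity _
  have hDc : D = 2 + 11 / c := by
    rw [integral_const_mul] at hint
    rw [hDdef, eq_inv_of_mul_eq_one_right hint, abs_of_pos (inv_pos.2 hc), div_eq_mul_inv]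
  have hγ0 : 0 ≤ 1 - 1 / α := by
    rw [sub_nonneg, div_le_one (by linarith)]; exact hα1.le
  have hγ1 : 1 - 1 / α ≤ 1 / 2 := by
    linarith [one_div_le_one_div_of_le (by linarith) hα2.le]
  rw [mul_div_cancel_left₀ _ (two_ne_zero' ℝ)]
  set I : Fin N → ℝ := fun i => l1norm (expAlphaPi α c N) (pderiv N i f) with hIdef
  have hI : ∀ i, 0 ≤ I i := fun i => l1norm_nonneg _ _
  set L : Fin N → ℝ := fun i => max (Real.log (1 / I i)) 0
  have hL : ∀ i, 0 ≤ L i := fun i => le_max_right _ _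
  set K : Fin N → ℕ := fun i => ⌊L i⌋₊ + 1
  have ha := fun i k => cubeAvg_abs_bitDeriv_cellMean_le K hα1 hα2 hc hf hb i k (hi i)
  rw [← hDc] at ha
  refine (var'_le_add K hα1 hα2 hc hf hb hi hM (fun i => 1 + L i)
    (fun i => by linarith [hL i]) fun i k => ?_).trans ?_
  · refine le_mul_exp_neg_one_add_log (hI i)
      (cubeAvg_abs_bitDeriv_le_one _ fun x => abs_cellMean_le K hb _) ((ha i k).trans ?_)
    have hX : ((1 + (K i - (k.1 + 1) : ℕ) : ℝ) ^ (1 - 1 / α))⁻¹ ≤ 1 :=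
      inv_le_one_of_one_le₀ (Real.one_le_rpow (le_add_of_nonneg_right (Nat.cast_nonneg _)) hγ0)
    have := hI i
    calc 2 * (D * ((1 + (K i - (k.1 + 1) : ℕ) : ℝ) ^ (1 - 1 / α))⁻¹) * I i
        ≤ 2 * (D * 1) * I i := by gcongr
      _ = _ := by ring
  · rw [Finset.mul_sum, ← hDc]
    exact Finset.sum_le_sum fun i _ => coordinate_sum_le hγ0 hγ1 hD.le (by linarith) (hI i) (hL i)
      rfl _ (ha i)
end

section
/- Let φ : [0,∞) → [0,∞) be a convex function with φ(0) = 0 and φ(x) = x²/log(e + x) for x ≥ 1. There exists a numerical constant C > 0 such that for every probability space (X, 𝒜, μ) and every measurable function g : X → ℝ with ‖g‖_φ < ∞, ∫_1^2 ‖g‖_v² dv ≤ C ‖g‖_φ², where ‖g‖_φ = inf{c > 0 : ∫_X φ(|g|/c) dμ ≤ 1} and ‖g‖_v = (∫_X |g|^v dμ)^{1/v}. -/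
open MeasureTheory

/-- The Luxemburg (Orlicz) norm associated to `φ`:
`‖g‖_φ = inf {c > 0 : ∫ φ(|g|/c) dμ ≤ 1}`. -/
noncomputable def luxNorm {X : Type*} [MeasurableSpace X] (μ : Measure X)
    (φ : ℝ → ℝ) (g : X → ℝ) : ℝ :=
  sInf {c : ℝ | 0 < c ∧ ∫⁻ x, ENNReal.ofReal (φ (|g x| / c)) ∂μ ≤ 1}

lemma log_exp_one_add_le {m : ℝ} (hm : 1 ≤ m) :
    Real.log (Real.exp 1 + m) ≤ 2 + Real.log m := by
  have h1 : Real.exp 1 + m ≤ Real.exp 2 * m := by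
    have h2 : Real.exp 2 = Real.exp 1 * Real.exp 1 := by
      rw [← Real.exp_add]; norm_num
    have h3 := Real.add_one_le_exp (1 : ℝ)
    rw [h2]
    nlinarith [mul_le_mul_of_nonneg_left hm (Real.exp_pos 1).le,
      mul_le_mul_of_nonneg_right h3 (show 0 ≤ Real.exp 1 * m by positivity)]
  calc Real.log (Real.exp 1 + m) ≤ Real.log (Real.exp 2 * m) :=
        Real.log_le_log (by positivity) h1
    _ = 2 + Real.log m := by
        rw [Real.log_mul (by positivity) (by positivity), Real.log_exp]

lemma log_exp_one_add_pos {m : ℝ} (hm : 1 ≤ m) : 0 < Real.log (Real.exp 1 + m) :=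
  Real.log_pos (by linarith [Real.exp_pos 1])

lemma rpow_le_div_mul_sq_div_log {m v : ℝ} (hm : 1 ≤ m) (h1 : 1 < v) (h2 : v < 2) :
    m ^ v ≤ 3 / (2 - v) * (m ^ 2 / Real.log (Real.exp 1 + m)) := by
  have ht : 0 < 2 - v := by linarith
  have hm0 : 0 < m := by linarith
  have hL := log_exp_one_add_pos hm
  have hlog : Real.log m ≤ m ^ (2 - v) / (2 - v) := Real.log_le_rpow_div hm0.le ht
  have hmt : 1 ≤ m ^ (2 - v) := Real.one_le_rpow hm ht.le
  have htwo : 2 ≤ 2 * m ^ (2 - v) / (2 - v) := by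
    rw [le_div_iff₀ ht]; nlinarith
  have hle : Real.log (Real.exp 1 + m) ≤ 3 * m ^ (2 - v) / (2 - v) := by
    calc _ ≤ 2 + Real.log m := log_exp_one_add_le hm
      _ ≤ 2 * m ^ (2 - v) / (2 - v) + m ^ (2 - v) / (2 - v) := add_le_add htwo hlog
      _ = _ := by ring
  have hsq : m ^ v * m ^ (2 - v) = m ^ 2 := by
    rw [← Real.rpow_add hm0, ← Real.rpow_natCast]; norm_num
  rw [← mul_div_assoc, le_div_iff₀ hL, ← hsq]
  calc m ^ v * Real.log (Real.exp 1 + m) ≤ m ^ v * (3 * m ^ (2 - v) / (2 - v)) := by gcongr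
    _ = _ := by ring

lemma intervalIntegral_rpow_le {m : ℝ} (hm : 1 ≤ m) :
    ∫ v in (1:ℝ)..2, m ^ v ≤ 4 * (m ^ 2 / Real.log (Real.exp 1 + m)) := by
  have hm0 : 0 < m := by linarith
  have hL := log_exp_one_add_pos hm
  have hcont : Continuous fun v : ℝ => m ^ v := Real.continuous_const_rpow hm0.ne'
  have hfund : ∫ v in (1:ℝ)..2, m ^ v * Real.log m = m ^ (2:ℝ) - m ^ (1:ℝ) :=
    intervalIntegral.integral_eq_sub_of_hasDerivAt
      (fun v _ => (Real.hasStrictDerivAt_const_rpow hm0 v).hasDerivAt)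
      ((hcont.mul continuous_const).intervalIntegrable _ _)
  rw [intervalIntegral.integral_mul_const, Real.rpow_two, Real.rpow_one] at hfund
  have hbound : ∫ v in (1:ℝ)..2, m ^ v ≤ m ^ 2 := by
    calc ∫ v in (1:ℝ)..2, m ^ v ≤ ∫ v in (1:ℝ)..2, m ^ (2:ℝ) :=
          intervalIntegral.integral_mono_on (by norm_num) (hcont.intervalIntegrable _ _)
            intervalIntegrable_const
            (fun v hv => Real.rpow_le_rpow_of_exponent_le hm hv.2)
      _ = m ^ 2 := by rw [intervalIntegral.integral_const, Real.rpow_two]; norm_num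
  have hnn : 0 ≤ ∫ v in (1:ℝ)..2, m ^ v :=
    intervalIntegral.integral_nonneg (by norm_num) (fun v _ => by positivity)
  rw [← mul_div_assoc, le_div_iff₀ hL]
  nlinarith [mul_le_mul_of_nonneg_left (log_exp_one_add_le hm) hnn]

lemma rpow_two_div_le {M v : ℝ} (hM : 1 ≤ M) (h1 : 1 < v) (h2 : v < 2)
    (hMv : M ≤ 6 / (2 - v)) : M ^ (2 / v) ≤ 18 * M := by
  have ht : 0 < 2 - v := by linarith
  have hM0 : 0 < M := by linarith
  have hexp : 2 / v ≤ 1 + (2 - v) := by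
    rw [div_le_iff₀ (by linarith)]; nlinarith
  have hinv : (1 / (2 - v)) ^ (2 - v) ≤ 3 := by
    rw [Real.rpow_def_of_pos (by positivity)]
    refine le_trans (Real.exp_le_exp.2 ?_) (Real.exp_one_lt_d9.le.trans (by norm_num))
    have := Real.log_le_self (show (0:ℝ) ≤ 1 / (2 - v) by positivity)
    calc Real.log (1 / (2 - v)) * (2 - v) ≤ 1 / (2 - v) * (2 - v) := by gcongr
      _ = 1 := by field_simp
  have hsix : (6:ℝ) ^ (2 - v) ≤ 6 := by
    simpa using Real.rpow_le_rpow_of_exponent_le (x := 6) (by norm_num)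
      (show 2 - v ≤ 1 by linarith)
  calc M ^ (2 / v) ≤ M ^ (1 + (2 - v)) := Real.rpow_le_rpow_of_exponent_le hM hexp
    _ = M * M ^ (2 - v) := by rw [Real.rpow_add hM0, Real.rpow_one]
    _ ≤ M * (6 * (1 / (2 - v))) ^ (2 - v) := by
        gcongr; rw [mul_one_div]; exact hMv
    _ = M * (6 ^ (2 - v) * (1 / (2 - v)) ^ (2 - v)) := by
        rw [Real.mul_rpow (by norm_num) (by positivity)]
    _ ≤ M * (6 * 3) := by gcongr
    _ = 18 * M := by ring

section

variable {X : Type*} [MeasurableSpace X] {μ : Measure X} {m : X → ℝ}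

lemma lintegral_rpow_le_of_lintegral_sq_div_log (hm : ∀ x, 1 ≤ m x)
    (hint : ∫⁻ x, ENNReal.ofReal (m x ^ 2 / Real.log (Real.exp 1 + m x)) ∂μ ≤ 2)
    {v : ℝ} (h1 : 1 < v) (h2 : v < 2) :
    ∫⁻ x, ENNReal.ofReal (m x ^ v) ∂μ ≤ ENNReal.ofReal (6 / (2 - v)) := by
  have ht : 0 < 2 - v := by linarith
  calc ∫⁻ x, ENNReal.ofReal (m x ^ v) ∂μ
      ≤ ∫⁻ x, ENNReal.ofReal (3 / (2 - v)) *
          ENNReal.ofReal (m x ^ 2 / Real.log (Real.exp 1 + m x)) ∂μ := by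
        refine lintegral_mono fun x => ?_
        rw [← ENNReal.ofReal_mul (by positivity)]
        exact ENNReal.ofReal_le_ofReal (rpow_le_div_mul_sq_div_log (hm x) h1 h2)
    _ = ENNReal.ofReal (3 / (2 - v)) *
          ∫⁻ x, ENNReal.ofReal (m x ^ 2 / Real.log (Real.exp 1 + m x)) ∂μ :=
        lintegral_const_mul' _ _ ENNReal.ofReal_ne_top
    _ ≤ ENNReal.ofReal (3 / (2 - v)) * ENNReal.ofReal 2 := by
        gcongr; simpa using hint
    _ = ENNReal.ofReal (6 / (2 - v)) := by
        rw [← ENNReal.ofReal_mul (by positivity)]; congr 1; ring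

lemma lintegral_lintegral_rpow_le [SFinite μ] (hmeas : Measurable m) (hm : ∀ x, 1 ≤ m x)
    (hint : ∫⁻ x, ENNReal.ofReal (m x ^ 2 / Real.log (Real.exp 1 + m x)) ∂μ ≤ 2) :
    ∫⁻ v in Set.Ioo (1:ℝ) 2, ∫⁻ x, ENNReal.ofReal (m x ^ v) ∂μ ≤ 8 := by
  have hmeas2 : Measurable fun p : ℝ × X => ENNReal.ofReal (m p.2 ^ p.1) := by fun_prop
  rw [lintegral_lintegral_swap hmeas2.aemeasurable]
  calc ∫⁻ x, (∫⁻ v in Set.Ioo (1:ℝ) 2, ENNReal.ofReal (m x ^ v)) ∂μ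
      ≤ ∫⁻ x, 4 * ENNReal.ofReal (m x ^ 2 / Real.log (Real.exp 1 + m x)) ∂μ := by
        refine lintegral_mono fun x => ?_
        have hx0 : 0 < m x := by linarith [hm x]
        have hcont : Continuous fun v : ℝ => m x ^ v := Real.continuous_const_rpow hx0.ne'
        have hI : IntegrableOn (fun v : ℝ => m x ^ v) (Set.Ioo 1 2) :=
          (hcont.integrableOn_Icc (a := 1) (b := 2)).mono_set Set.Ioo_subset_Icc_self
        have h4 : (4 : ENNReal) = ENNReal.ofReal 4 := by simp
        rw [← ofReal_integral_eq_lintegral_ofReal hI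
          (Filter.Eventually.of_forall fun v => by positivity), h4,
          ← ENNReal.ofReal_mul (by norm_num), ← integral_Ioc_eq_integral_Ioo,
          ← intervalIntegral.integral_of_le (by norm_num)]
        exact ENNReal.ofReal_le_ofReal (intervalIntegral_rpow_le (hm x))
    _ = 4 * ∫⁻ x, ENNReal.ofReal (m x ^ 2 / Real.log (Real.exp 1 + m x)) ∂μ :=
        lintegral_const_mul' _ _ (by norm_num)
    _ ≤ 4 * 2 := by gcongr
    _ = 8 := by norm_num

lemma ofReal_integral_rpow_le [IsProbabilityMeasure μ] (hmeas : Measurable m)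
    (hm : ∀ x, 1 ≤ m x)
    (hint : ∫⁻ x, ENNReal.ofReal (m x ^ 2 / Real.log (Real.exp 1 + m x)) ∂μ ≤ 2)
    {g : X → ℝ} {c : ℝ} (hc : 0 < c) (hg : ∀ x, |g x| ≤ c * m x)
    {v : ℝ} (h1 : 1 < v) (h2 : v < 2) :
    ENNReal.ofReal ((∫ x, |g x| ^ v ∂μ) ^ (2 / v)) ≤
      ENNReal.ofReal (18 * c ^ 2) * ∫⁻ x, ENNReal.ofReal (m x ^ v) ∂μ := by
  have ht : 0 < 2 - v := by linarith
  have hv0 : 0 < v := by linarith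
  have hm0 : ∀ x, 0 ≤ m x := fun x => by linarith [hm x]
  have hJ := lintegral_rpow_le_of_lintegral_sq_div_log hm hint h1 h2
  have hnn : 0 ≤ᵐ[μ] fun x => m x ^ v :=
    Filter.Eventually.of_forall fun x => Real.rpow_nonneg (hm0 x) v
  have hI : Integrable (fun x => m x ^ v) μ :=
    ⟨(by fun_prop : Measurable fun x => m x ^ v).aestronglyMeasurable,
      (hasFiniteIntegral_iff_ofReal hnn).2 (hJ.trans_lt ENNReal.ofReal_lt_top)⟩
  rw [← ofReal_integral_eq_lintegral_ofReal hI hnn] at hJ ⊢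
  rw [← ENNReal.ofReal_mul (by positivity)]
  have hM : ∫ x, m x ^ v ∂μ ≤ 6 / (2 - v) :=
    (ENNReal.ofReal_le_ofReal_iff (by positivity)).1 hJ
  have hM1 : 1 ≤ ∫ x, m x ^ v ∂μ := by
    simpa using integral_mono (integrable_const (1:ℝ)) hI
      (fun x => Real.one_le_rpow (hm x) hv0.le)
  have hG : ∫ x, |g x| ^ v ∂μ ≤ c ^ v * ∫ x, m x ^ v ∂μ := by
    rw [← integral_const_mul]
    refine integral_mono_of_nonneg
      (Filter.Eventually.of_forall fun x => Real.rpow_nonneg (abs_nonneg _) _)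
      (hI.const_mul _) (Filter.Eventually.of_forall fun x => ?_)
    change |g x| ^ v ≤ c ^ v * m x ^ v
    rw [← Real.mul_rpow hc.le (hm0 x)]
    exact Real.rpow_le_rpow (abs_nonneg _) (hg x) hv0.le
  apply ENNReal.ofReal_le_ofReal
  calc (∫ x, |g x| ^ v ∂μ) ^ (2 / v) ≤ (c ^ v * ∫ x, m x ^ v ∂μ) ^ (2 / v) :=
        Real.rpow_le_rpow (integral_nonneg fun x => Real.rpow_nonneg (abs_nonneg _) _) hG
          (by positivity)
    _ = c ^ 2 * (∫ x, m x ^ v ∂μ) ^ (2 / v) := by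
        rw [Real.mul_rpow (by positivity) (by linarith), ← Real.rpow_mul hc.le,
          mul_div_cancel₀ _ hv0.ne', Real.rpow_two]
    _ ≤ c ^ 2 * (18 * ∫ x, m x ^ v ∂μ) := by
        gcongr; exact rpow_two_div_le hM1 h1 h2 hM
    _ = 18 * c ^ 2 * ∫ x, m x ^ v ∂μ := by ring

lemma intervalIntegral_integral_rpow_le [IsProbabilityMeasure μ] (hmeas : Measurable m)
    (hm : ∀ x, 1 ≤ m x)
    (hint : ∫⁻ x, ENNReal.ofReal (m x ^ 2 / Real.log (Real.exp 1 + m x)) ∂μ ≤ 2)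
    {g : X → ℝ} {c : ℝ} (hc : 0 < c) (hg : ∀ x, |g x| ≤ c * m x) :
    ∫ v in (1:ℝ)..2, (∫ x, |g x| ^ v ∂μ) ^ (2 / v) ≤ 144 * c ^ 2 := by
  rw [intervalIntegral.integral_of_le (by norm_num), integral_Ioc_eq_integral_Ioo]
  rw [← ENNReal.ofReal_le_ofReal_iff (by positivity)]
  have hnn : ∀ v : ℝ, 0 ≤ (∫ x, |g x| ^ v ∂μ) ^ (2 / v) := fun v =>
    Real.rpow_nonneg (integral_nonneg fun x => Real.rpow_nonneg (abs_nonneg _) _) _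
  calc ENNReal.ofReal (∫ v in Set.Ioo (1:ℝ) 2, (∫ x, |g x| ^ v ∂μ) ^ (2 / v))
      = ‖∫ v in Set.Ioo (1:ℝ) 2, (∫ x, |g x| ^ v ∂μ) ^ (2 / v)‖ₑ :=
        (Real.enorm_of_nonneg (integral_nonneg hnn)).symm
    _ ≤ ∫⁻ v in Set.Ioo (1:ℝ) 2, ‖(∫ x, |g x| ^ v ∂μ) ^ (2 / v)‖ₑ :=
        enorm_integral_le_lintegral_enorm _
    _ ≤ ∫⁻ v in Set.Ioo (1:ℝ) 2,
          ENNReal.ofReal (18 * c ^ 2) * ∫⁻ x, ENNReal.ofReal (m x ^ v) ∂μ := by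
        refine setLIntegral_mono' measurableSet_Ioo fun v hv => ?_
        rw [Real.enorm_of_nonneg (hnn v)]
        exact ofReal_integral_rpow_le hmeas hm hint hc hg hv.1 hv.2
    _ = ENNReal.ofReal (18 * c ^ 2) *
          ∫⁻ v in Set.Ioo (1:ℝ) 2, ∫⁻ x, ENNReal.ofReal (m x ^ v) ∂μ :=
        lintegral_const_mul' _ _ ENNReal.ofReal_ne_top
    _ ≤ ENNReal.ofReal (18 * c ^ 2) * ENNReal.ofReal 8 := by
        gcongr; simpa using lintegral_lintegral_rpow_le hmeas hm hint
    _ = ENNReal.ofReal (144 * c ^ 2) := by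
        rw [← ENNReal.ofReal_mul (by positivity)]; congr 1; ring

end

lemma lintegral_sq_div_log_max_one_le {X : Type*} [MeasurableSpace X] {μ : Measure X}
    [IsProbabilityMeasure μ] {φ : ℝ → ℝ}
    (hφ : ∀ x : ℝ, 1 ≤ x → φ x = x ^ 2 / Real.log (Real.exp 1 + x)) {f : X → ℝ}
    (hf : ∫⁻ x, ENNReal.ofReal (φ (f x)) ∂μ ≤ 1) :
    ∫⁻ x, ENNReal.ofReal ((max (f x) 1) ^ 2 / Real.log (Real.exp 1 + max (f x) 1)) ∂μ ≤ 2 := by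
  have hφ1 : φ 1 ≤ 1 := by
    rw [hφ 1 le_rfl, one_pow]
    have hlog : 1 ≤ Real.log (Real.exp 1 + 1) := by
      rw [Real.le_log_iff_exp_le (by positivity)]; linarith
    exact div_le_one_of_le₀ hlog (by linarith)
  calc _ ≤ ∫⁻ x, (ENNReal.ofReal (φ (f x)) + 1) ∂μ := by
        refine lintegral_mono fun x => ?_
        rw [← hφ _ (le_max_right _ _)]
        rcases le_total (f x) 1 with h | h
        · rw [max_eq_right h]
          exact (ENNReal.ofReal_le_one.2 hφ1).trans le_add_self
        · rw [max_eq_left h]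
          exact le_self_add
    _ = ∫⁻ x, ENNReal.ofReal (φ (f x)) ∂μ + 1 := by
        rw [lintegral_add_right _ measurable_const]; simp
    _ ≤ 1 + 1 := by gcongr
    _ = 2 := one_add_one_eq_two

/-- Comparison between `∫_1^2 ‖g‖_v² dv` and the Orlicz norm `‖g‖_φ` for
`φ(x) = x²/log(e+x)` (`x ≥ 1`), on an arbitrary probability space. -/
theorem stmt19 (φ : ℝ → ℝ) (hconv : ConvexOn ℝ (Set.Ici 0) φ) (h0 : φ 0 = 0)
    (hnonneg : ∀ x, 0 ≤ x → 0 ≤ φ x)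
    (hφ : ∀ x : ℝ, 1 ≤ x → φ x = x ^ 2 / Real.log (Real.exp 1 + x)) :
    ∃ C : ℝ, 0 < C ∧
      ∀ (X : Type) (_ : MeasurableSpace X) (μ : Measure X), IsProbabilityMeasure μ →
      ∀ g : X → ℝ, Measurable g →
      {c : ℝ | 0 < c ∧ ∫⁻ x, ENNReal.ofReal (φ (|g x| / c)) ∂μ ≤ 1}.Nonempty →
      (∫ v in (1:ℝ)..2, (∫ x, |g x| ^ v ∂μ) ^ (2 / v)) ≤ C * luxNorm μ φ g ^ 2 := by
  refine ⟨144, by norm_num, fun X _ μ _ g hg hne => ?_⟩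
  have hbound : ∀ c : ℝ, 0 < c → ∫⁻ x, ENNReal.ofReal (φ (|g x| / c)) ∂μ ≤ 1 →
      ∫ v in (1:ℝ)..2, (∫ x, |g x| ^ v ∂μ) ^ (2 / v) ≤ 144 * c ^ 2 := fun c hc hc1 =>
    intervalIntegral_integral_rpow_le (m := fun x => max (|g x| / c) 1)
      (by fun_prop) (fun x => le_max_right _ _)
      (lintegral_sq_div_log_max_one_le hφ hc1) hc fun x => by
        rw [← div_le_iff₀' hc]; exact le_max_left _ _
  set A := ∫ v in (1:ℝ)..2, (∫ x, |g x| ^ v ∂μ) ^ (2 / v)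
  have hsqrt : √(A / 144) ≤ luxNorm μ φ g := by
    refine le_csInf hne fun c hc => Real.sqrt_le_iff.2 ⟨hc.1.le, ?_⟩
    rw [div_le_iff₀' (by norm_num)]
    exact hbound c hc.1 hc.2
  have := (Real.sqrt_le_iff.1 hsqrt).2
  rwa [div_le_iff₀' (by norm_num)] at this
end
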